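/- arXiv:2108.09390 — 7 statements merged into one kernel-verified Lean document; each statement's English description precedes it below -/
import Mathlib

section
/- The class of EDT0L languages is closed under the following operations: (1) finite unions; (2) intersection with regular languages; (3) concatenation; (4) Kleene star; and (5) images under free monoid homomorphisms. That is, if L and M are EDT0L languages over finite alphabets, R is a regular language, and φ is a monoid homomorphism between the relevant free monoids, then L ∪ M, L ∩ R, the concatenation LM, the Kleene star L*, and the image Lφ are all EDT0L. -/
namespace Paper

/-- Apply a letterwise substitution (i.e. the endomorphism of the free monoid `C*`
determined by its action on letters) to a word over `C`. -/
def subApply {C : Type*} (f : C → List C) (w : List C) : List C := (w.map f).flatten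

/-- An EDT0L system: a finite extended alphabet `C`, an identification of some letters of
`C` with terminal letters of the alphabet `α` (injectively, modelling `Σ ⊆ C`), a start
word over `C`, and a rational control: a regular language over a finite set of letterwise
substitutions (endomorphisms of `C*`), a word of endomorphisms acting by composition. -/
structure EDT0LSystem (α : Type*) where
  C : Type
  finC : Fintype C
  term : C → Option α
  term_inj : ∀ c c' a, term c = some a → term c' = some a → c = c'
  start : List C
  ι : Type
  finι : Fintype ι
  tab : ι → C → List C
  control : Language ι
  control_reg : control.IsRegular

/-- The endomorphism of `C*` given by a word of basic endomorphisms, applied to `w`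
(the word `φ₁φ₂⋯φₖ` acts as `φ₁∘φ₂∘⋯∘φₖ`, functions written on the right). -/
def EDT0LSystem.apply {α : Type*} (S : EDT0LSystem α) (φs : List S.ι) (w : List S.C) :
    List S.C :=
  φs.foldl (fun v i => subApply (S.tab i) v) w

/-- The language accepted by an EDT0L system: `{ωφ : φ ∈ R} ∩ Σ*`. -/
def EDT0LSystem.accepts {α : Type*} (S : EDT0LSystem α) : Language α :=
  { w | ∃ φs ∈ S.control, (S.apply φs S.start).map S.term = w.map Option.some }

/-- A language is EDT0L if it is accepted by some EDT0L system. -/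
def IsEDT0L {α : Type*} (L : Language α) : Prop := ∃ S : EDT0LSystem α, S.accepts = L

/-- Evaluate a word over the alphabet `Σ ∪ Σ⁻¹` (a letter is a generator index together
with a sign) in a group. -/
def evalWord {G : Type*} [Group G] {ι : Type*} (gen : ι → G) (w : List (ι × Bool)) : G :=
  (w.map fun l => if l.2 then gen l.1 else (gen l.1)⁻¹).prod

/-- The word length of `g` with respect to the generating set `gen`. -/
noncomputable def wordLength {G : Type*} [Group G] {ι : Type*} (gen : ι → G) (g : G) : ℕ :=
  sInf {n | ∃ w : List (ι × Bool), evalWord gen w = g ∧ w.length = n}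

/-- A normal form is quasigeodesic if `|η(g)| ≤ λ·|g| + λ` for some `λ > 0`. -/
def IsQuasigeodesicNF {G : Type*} [Group G] {ι : Type*} (gen : ι → G)
    (η : G → List (ι × Bool)) : Prop :=
  ∃ lam : ℝ, 0 < lam ∧ ∀ g : G, ((η g).length : ℝ) ≤ lam * (wordLength gen g) + lam

/-- A normal form is regular if its image is a regular language. -/
def IsRegularNF {G : Type*} [Group G] {ι : Type*} (η : G → List (ι × Bool)) : Prop :=
  Language.IsRegular (Set.range η : Language (ι × Bool))

/-- A subset of a group is rational if it is the image of a regular language under the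
evaluation map from the free monoid on a finite monoid generating set. -/
def IsRationalSubset {G : Type*} [Group G] (A : Set G) : Prop :=
  ∃ (ι : Type) (_ : Fintype ι) (gen : ι → G) (L : Language ι),
    Submonoid.closure (Set.range gen) = ⊤ ∧ L.IsRegular ∧
      A = (fun w : List ι => (w.map gen).prod) '' L

/-- A subset of a group is recognisable if its full preimage under the evaluation map
from the free monoid on a finite monoid generating set is a regular language. -/
def IsRecognisableSubset {G : Type*} [Group G] (A : Set G) : Prop :=
  ∃ (ι : Type) (_ : Fintype ι) (gen : ι → G),
    Submonoid.closure (Set.range gen) = ⊤ ∧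
      Language.IsRegular ({w : List ι | (w.map gen).prod ∈ A} : Language ι)

/-- The word `w₁ # w₂ # ⋯ # wₘ` over `β ⊕ {#}`. -/
def hashWord {β : Type*} {m : ℕ} (ws : Fin m → List β) : List (β ⊕ Unit) :=
  List.intercalate [Sum.inr ()] (List.ofFn fun i => (ws i).map Sum.inl)

/-- `g : Fin m → G` is a solution of the system `E ⊆ G ∗ F_X` of equations. -/
def SolvesSystem {G : Type*} [Group G] {m : ℕ}
    (E : Set (Monoid.Coprod G (FreeGroup (Fin m)))) (g : Fin m → G) : Prop :=
  ∀ e ∈ E, Monoid.Coprod.lift (MonoidHom.id G) (FreeGroup.lift g) e = 1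

/-- The solution language of a system of equations with constraints, w.r.t. a normal form. -/
def solutionLanguageC {G : Type*} [Group G] {ι : Type*} (η : G → List (ι × Bool)) {m : ℕ}
    (E : Set (Monoid.Coprod G (FreeGroup (Fin m)))) (Rc : Fin m → Set G) :
    Language ((ι × Bool) ⊕ Unit) :=
  { w | ∃ g : Fin m → G, SolvesSystem E g ∧ (∀ i, g i ∈ Rc i) ∧
      w = hashWord fun i => η (g i) }

/-- The solution language of a system of equations, w.r.t. a normal form. -/
def solutionLanguage {G : Type*} [Group G] {ι : Type*} (η : G → List (ι × Bool)) {m : ℕ}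
    (E : Set (Monoid.Coprod G (FreeGroup (Fin m)))) : Language ((ι × Bool) ⊕ Unit) :=
  solutionLanguageC η E fun _ => Set.univ

/-- Evaluate a twisted word (a word over `H ∪ (F_X × Ω)`) at the assignment `g` of the
variables: each letter `(u, ψ)` becomes `ψ(uφ)` where `φ` is the homomorphism `F_X → H`
determined by `g`, and the word is multiplied out in `H`. -/
def twistedEval {H : Type*} [Group H] {m : ℕ} (Ω : Subgroup (MulAut H)) (g : Fin m → H)
    (w : List (H ⊕ (FreeGroup (Fin m) × Ω))) : H :=
  (w.map (Sum.elim id fun p => (p.2 : MulAut H) (FreeGroup.lift g p.1))).prod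

/-- The solution language of a system of `Ω`-twisted equations with constraints. -/
def twistedSolutionLanguage {H : Type*} [Group H] {ι : Type*} (Ω : Subgroup (MulAut H))
    (η : H → List (ι × Bool)) {m : ℕ}
    (E : Set (List (H ⊕ (FreeGroup (Fin m) × Ω)))) (Rc : Fin m → Set H) :
    Language ((ι × Bool) ⊕ Unit) :=
  { w | ∃ g : Fin m → H, (∀ e ∈ E, twistedEval Ω g e = 1) ∧ (∀ i, g i ∈ Rc i) ∧
      w = hashWord fun i => η (g i) }


/-! ### Closure properties of regular languages -/

section Regular

variable {A B : Type}

theorem isRegular_of_forall_leftQuotient_mem {L : Language A} {s : Set (Language A)}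
    (hs : s.Finite) (h : ∀ x, L.leftQuotient x ∈ s) : L.IsRegular :=
  .of_finite_range_leftQuotient (hs.subset (Set.range_subset_iff.2 h))

theorem isRegular_singleton_singleton (a : A) : ({[a]} : Language A).IsRegular := by
  refine isRegular_of_forall_leftQuotient_mem (s := {{[a]}, {[]}, 0}) (by simp) fun x => ?_
  rcases x with _ | ⟨b, _ | ⟨c, x⟩⟩
  · left; rfl
  · by_cases h : b = a
    · right; left
      ext w
      subst h
      change [b] ++ w = [b] ↔ w = []
      simp
    · right; right
      ext w
      change [b] ++ w = [a] ↔ False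
      simp [h]
  · right; right
    ext w
    change (b :: c :: x) ++ w = [a] ↔ False
    simp

theorem IsRegular.mul {L M : Language A} (hL : L.IsRegular) (hM : M.IsRegular) :
    (L * M).IsRegular := by
  refine isRegular_of_forall_leftQuotient_mem
    (s := Set.image2 (fun P s => P * M + sSup s) (Set.range L.leftQuotient)
      (Set.powerset (Set.range M.leftQuotient)))
    (hL.finite_range_leftQuotient.image2 _ hM.finite_range_leftQuotient.finite_subsets)
    fun x => ⟨_, ⟨x, rfl⟩, {N | ∃ u ∈ L, ∃ v, u ++ v = x ∧ M.leftQuotient v = N}, ?_, ?_⟩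
  · rintro _ ⟨u, -, v, -, rfl⟩
    exact ⟨v, rfl⟩
  · ext w
    simp only [Language.mem_add, Language.mem_leftQuotient, Language.mem_mul]
    constructor
    · rintro (⟨a, ha, b, hb, rfl⟩ | ⟨_, ⟨u, hu, v, rfl, rfl⟩, hw⟩)
      · exact ⟨x ++ a, ha, b, hb, by simp⟩
      · exact ⟨u, hu, v ++ w, hw, by simp⟩
    · rintro ⟨a, ha, b, hb, hab⟩
      rcases List.append_eq_append_iff.1 hab with ⟨c, rfl, rfl⟩ | ⟨c, rfl, rfl⟩
      · exact .inr ⟨_, ⟨a, ha, c, rfl, rfl⟩, hb⟩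
      · exact .inl ⟨c, ha, b, hb, rfl⟩

theorem IsRegular.kstar {L : Language A} (hL : L.IsRegular) :
    (KStar.kstar L).IsRegular := by
  refine isRegular_of_forall_leftQuotient_mem
    (s := insert (KStar.kstar L)
      ((fun s => sSup s * KStar.kstar L) '' Set.powerset (Set.range L.leftQuotient)))
    ((hL.finite_range_leftQuotient.finite_subsets.image _).insert _) fun x => ?_
  rcases eq_or_ne x [] with rfl | hx
  · left; rfl
  refine .inr ⟨{N | ∃ u ∈ KStar.kstar L, ∃ v, u ++ v = x ∧ L.leftQuotient v = N}, ?_, ?_⟩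
  · rintro _ ⟨u, -, v, -, rfl⟩
    exact ⟨v, rfl⟩
  ext w
  simp only [Language.mem_leftQuotient, Language.mem_mul]
  constructor
  · rintro ⟨a, ⟨_, ⟨u, hu, v, rfl, rfl⟩, ha⟩, b, hb, rfl⟩
    obtain ⟨us, rfl, hus⟩ := Language.mem_kstar.1 hu
    obtain ⟨bs, rfl, hbs⟩ := Language.mem_kstar.1 hb
    refine Language.mem_kstar.2 ⟨us ++ (v ++ a) :: bs, by simp, fun y hy => ?_⟩
    rcases List.mem_append.1 hy with hy | hy
    · exact hus y hy
    · rcases List.mem_cons.1 hy with rfl | hy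
      exacts [ha, hbs y hy]
  · intro h
    obtain ⟨ys, hys, hmem⟩ := Language.mem_kstar.1 h
    clear h
    induction ys generalizing x with
    | nil => simp_all
    | cons y ys ih =>
      have hy := hmem y (by simp)
      have hmem' : ∀ z ∈ ys, z ∈ L := fun z hz => hmem z (by simp [hz])
      rw [List.flatten_cons] at hys
      rcases List.append_eq_append_iff.1 hys with ⟨c, rfl, rfl⟩ | ⟨c, rfl, hc⟩
      · exact ⟨c, ⟨_, ⟨[], Language.nil_mem_kstar _, x, rfl, rfl⟩, hy⟩, _,
          Language.join_mem_kstar hmem', rfl⟩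
      · rcases eq_or_ne c [] with rfl | hc0
        · refine ⟨[], ⟨_, ⟨[], Language.nil_mem_kstar _, y, by simp, rfl⟩, ?_⟩, w, ?_, rfl⟩
          · change y ++ [] ∈ L
            simpa using hy
          · rw [show w = ys.flatten by simpa using hc.symm]
            exact Language.join_mem_kstar hmem'
        · obtain ⟨a, ⟨_, ⟨u, hu, v, rfl, rfl⟩, ha⟩, b, hb, rfl⟩ := ih c hc0 hc.symm hmem'
          refine ⟨a, ⟨_, ⟨y ++ u, ?_, v, by simp, rfl⟩, ha⟩, b, hb, rfl⟩
          obtain ⟨us, rfl, hus⟩ := Language.mem_kstar.1 hu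
          exact Language.mem_kstar.2 ⟨y :: us, by simp, by simpa using ⟨hy, hus⟩⟩

theorem IsRegular.map_of_injective {f : A → B} (hf : Function.Injective f) {L : Language A}
    (hL : L.IsRegular) : (Language.map f L).IsRegular := by
  refine isRegular_of_forall_leftQuotient_mem
    (s := insert 0 (Language.map f '' Set.range L.leftQuotient))
    ((hL.finite_range_leftQuotient.image _).insert _) fun x => ?_
  by_cases hx : ∃ y : List A, y.map f = x
  · obtain ⟨y, rfl⟩ := hx
    refine .inr ⟨_, ⟨y, rfl⟩, ?_⟩
    ext w
    change (∃ z, y ++ z ∈ L ∧ z.map f = w) ↔ ∃ z ∈ L, z.map f = y.map f ++ w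
    constructor
    · rintro ⟨z, hz, rfl⟩
      exact ⟨_, hz, by simp⟩
    · rintro ⟨z, hz, h⟩
      obtain ⟨z₁, z₂, rfl, h₁, h₂⟩ := List.map_eq_append_iff.1 h
      obtain rfl := List.map_injective_iff.2 hf h₁
      exact ⟨z₂, hz, h₂⟩
  · left
    ext w
    change (∃ z ∈ L, z.map f = x ++ w) ↔ False
    refine ⟨?_, False.elim⟩
    rintro ⟨z, -, h⟩
    obtain ⟨z₁, z₂, -, h₁, -⟩ := List.map_eq_append_iff.1 h
    exact hx ⟨z₁, h₁⟩

theorem isRegular_forall_mem (p : A → Prop) :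
    Language.IsRegular ({w | ∀ a ∈ w, p a} : Language A) := by
  let L : Language A := {w | ∀ a ∈ w, p a}
  refine isRegular_of_forall_leftQuotient_mem (L := L) (s := {L, 0}) (Set.toFinite _)
    fun x => ?_
  by_cases hx : ∀ a ∈ x, p a
  · left
    ext w
    change (∀ a ∈ x ++ w, p a) ↔ ∀ a ∈ w, p a
    simp only [List.mem_append]
    grind
  · right
    ext w
    change (∀ a ∈ x ++ w, p a) ↔ False
    simp only [List.mem_append]
    grind

end Regular

/-! ### Iterated substitutions -/

section IterSub

variable {C ι A : Type}

/-- Apply a word of letterwise substitutions, from left to right, to a word. -/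
def iterSub (tab : ι → C → List C) (φs : List ι) (w : List C) : List C :=
  φs.foldl (fun v i => v.flatMap (tab i)) w

variable (tab : ι → C → List C)

@[simp] theorem iterSub_nil (w : List C) : iterSub tab [] w = w := rfl

@[simp] theorem iterSub_cons (i : ι) (φs : List ι) (w : List C) :
    iterSub tab (i :: φs) w = iterSub tab φs (w.flatMap (tab i)) := rfl

theorem iterSub_append (φs ψs : List ι) (w : List C) :
    iterSub tab (φs ++ ψs) w = iterSub tab ψs (iterSub tab φs w) :=
  List.foldl_append

theorem iterSub_word_append (φs : List ι) (v w : List C) :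
    iterSub tab φs (v ++ w) = iterSub tab φs v ++ iterSub tab φs w := by
  induction φs generalizing v w with
  | nil => rfl
  | cons i φs ih => simp [ih]

@[simp] theorem iterSub_word_nil (φs : List ι) : iterSub tab φs [] = [] := by
  induction φs with
  | nil => rfl
  | cons i φs ih => simpa

theorem iterSub_map {C' ι' : Type} {tab' : ι' → C' → List C'} {f : ι → ι'} {g : C → C'}
    (h : ∀ i c, tab' (f i) (g c) = (tab i c).map g) (φs : List ι) (w : List C) :
    iterSub tab' (φs.map f) (w.map g) = (iterSub tab φs w).map g := by
  induction φs generalizing w with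
  | nil => rfl
  | cons i φs ih =>
    simp only [List.map_cons, iterSub_cons, ← ih]
    simp [List.flatMap_map, List.map_flatMap, h]

theorem iterSub_of_forall_fixed (φs : List ι) (w : List C)
    (h : ∀ i ∈ φs, ∀ c ∈ w, tab i c = [c]) : iterSub tab φs w = w := by
  induction φs with
  | nil => rfl
  | cons i φs ih =>
    rw [iterSub_cons, List.flatMap_congr fun c hc => h i (by simp) c hc]
    simpa using ih fun j hj => h j (by simp [hj])

theorem isRegular_preimage_iterSub [Finite C] {R : Language A} (hR : R.IsRegular)
    (start : List C) (out : C → List A) :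
    Language.IsRegular ({φs | (iterSub tab φs start).flatMap out ∈ R} : Language ι) := by
  obtain ⟨Q, _, M, rfl⟩ := hR
  refine .of_reverse ?_
  let N : DFA ι (C → Q → Q) :=
    { step := fun f i c q => (tab i c).foldl (fun q c => f c q) q
      start := fun c q => M.evalFrom q (out c)
      accept := {f | start.foldl (fun q c => f c q) M.start ∈ M.accept} }
  have hfold (φs : List ι) (w : List C) (q : Q) :
      w.foldl (fun q c => M.evalFrom q ((iterSub tab φs [c]).flatMap out)) q =
        M.evalFrom q ((iterSub tab φs w).flatMap out) := by
    induction w generalizing q with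
    | nil => simp
    | cons c w ih =>
      rw [List.foldl_cons, ih, ← DFA.evalFrom_of_append, ← List.flatMap_append,
        ← iterSub_word_append, List.singleton_append]
  have heval (φs : List ι) :
      N.eval φs.reverse = fun c q => M.evalFrom q ((iterSub tab φs [c]).flatMap out) := by
    induction φs with
    | nil => funext c q; simp [N]
    | cons i φs ih =>
      funext c q
      rw [List.reverse_cons, DFA.eval_append_singleton, ih]
      simp [N, hfold]
  refine ⟨_, Fintype.ofFinite _, N, ?_⟩
  ext φs
  rw [DFA.mem_accepts, ← φs.reverse_reverse, heval]
  change (start.foldl _ _ ∈ M.accept) ↔ _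
  rw [hfold]
  simp only [List.reverse_reverse]
  rfl

end IterSub

/-! ### Systems without a terminal alphabet -/

/-- `L` is the set of images, under a monoid homomorphism `out`, of the words obtained from a start
word by a rational set of substitutions. -/
def IsHDT0L {A : Type} (L : Language A) : Prop :=
  ∃ (C ι : Type) (_ : Finite C) (_ : Finite ι) (start : List C) (tab : ι → C → List C)
    (out : C → List A) (K : Language ι), K.IsRegular ∧
      ∀ w, w ∈ L ↔ ∃ φs ∈ K, (iterSub tab φs start).flatMap out = w

theorem map_eq_map_some_iff {C A : Type} (t : C → Option A) (v : List C) (w : List A) :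
    v.map t = w.map some ↔ (∀ c ∈ v, (t c).isSome) ∧ v.flatMap (fun c => (t c).toList) = w := by
  induction v generalizing w with
  | nil => cases w <;> simp
  | cons c v ih =>
    rcases h : t c with _ | a
    · cases w <;> simp [h]
    · cases w <;> simp [h, ih]
      grind

theorem IsEDT0L.isHDT0L {A : Type} {L : Language A} (h : IsEDT0L L) : IsHDT0L L := by
  obtain ⟨S, rfl⟩ := h
  have := S.finC
  have := S.finι
  refine ⟨S.C, S.ι, inferInstance, inferInstance, S.start, S.tab, fun c => (S.term c).toList, _,
    S.control_reg.inf (isRegular_preimage_iterSub S.tab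
      (isRegular_forall_mem fun c => ((S.term c).isSome : Prop)) S.start fun c => [c]),
    fun w => ?_⟩
  have happly : ∀ φs, S.apply φs S.start = iterSub S.tab φs S.start := fun φs => by
    simp [EDT0LSystem.apply, iterSub, subApply, List.flatMap_def]
  change (∃ φs ∈ S.control, (S.apply φs S.start).map S.term = w.map some) ↔
    ∃ φs, (φs ∈ S.control ∧ ∀ c ∈ (iterSub S.tab φs S.start).flatMap (fun c => [c]), _) ∧ _
  simp only [happly, map_eq_map_some_iff, and_assoc, List.flatMap_singleton']

theorem IsHDT0L.isEDT0L {A : Type} [Fintype A] {L : Language A} (h : IsHDT0L L) :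
    IsEDT0L L := by
  obtain ⟨C, ι, _, _, start, tab, out, K, hK, hL⟩ := h
  let tab' : Option ι → C ⊕ A → List (C ⊕ A)
    | some i, .inl c => (tab i c).map .inl
    | none, .inl c => (out c).map .inr
    | _, .inr a => [.inr a]
  refine ⟨{
    C := C ⊕ A
    finC := Fintype.ofFinite _
    term := Sum.elim (fun _ => none) some
    term_inj := by rintro (c | a) (c' | a') b <;> simp +contextual
    start := start.map .inl
    ι := Option ι
    finι := Fintype.ofFinite _
    tab := tab'
    control := Language.map some K * {[none]}
    control_reg := IsRegular.mul (IsRegular.map_of_injective (Option.some_injective _) hK)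
      (isRegular_singleton_singleton _) }, ?_⟩
  ext w
  rw [hL]
  have happly (φs : List ι) : iterSub tab' (φs.map some ++ [none]) (start.map .inl) =
      ((iterSub tab φs start).flatMap out).map .inr := by
    rw [iterSub_append, iterSub_map tab (fun _ _ => rfl)]
    simp [List.flatMap_map, List.map_flatMap, tab']
  have hsub (φs : List (Option ι)) (v : List (C ⊕ A)) :
      φs.foldl (fun v i => subApply (tab' i) v) v = iterSub tab' φs v := by
    simp [iterSub, subApply, List.flatMap_def]
  have hmap (u : List A) :
      (u.map (Sum.inr : A → C ⊕ A)).map (Sum.elim (fun _ => none) some) = w.map some ↔ u = w := by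
    rw [List.map_map]
    exact (List.map_injective_iff.2 (Option.some_injective A)).eq_iff
  constructor
  · rintro ⟨_, ⟨_, ⟨φs, hφs, rfl⟩, _, rfl, rfl⟩, h⟩
    refine ⟨φs, hφs, ?_⟩
    rw [EDT0LSystem.apply, hsub] at h
    exact (hmap _).1 ((congrArg _ (happly φs)).symm.trans h)
  · rintro ⟨φs, hφs, h⟩
    refine ⟨φs.map some ++ [none], ⟨_, ⟨φs, hφs, rfl⟩, _, rfl, rfl⟩, ?_⟩
    rw [EDT0LSystem.apply, hsub]
    exact (congrArg _ (happly φs)).trans ((hmap _).2 h)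

section Closure

variable {A B : Type}

theorem IsHDT0L.inter {L R : Language A} (hL : IsHDT0L L) (hR : R.IsRegular) :
    IsHDT0L ({w | w ∈ L ∧ w ∈ R} : Language A) := by
  obtain ⟨C, ι, hC, hι, start, tab, out, K, hK, hL⟩ := hL
  refine ⟨C, ι, hC, hι, start, tab, out, _,
    hK.inf (isRegular_preimage_iterSub tab hR start out), fun w => ?_⟩
  change w ∈ L ∧ w ∈ R ↔ ∃ φs, (φs ∈ K ∧ (iterSub tab φs start).flatMap out ∈ R) ∧ _
  rw [hL]
  constructor
  · rintro ⟨⟨φs, h, rfl⟩, hR⟩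
    exact ⟨φs, ⟨h, hR⟩, rfl⟩
  · rintro ⟨φs, ⟨h, hR⟩, rfl⟩
    exact ⟨⟨φs, h, rfl⟩, hR⟩

theorem IsHDT0L.image_flatMap {L : Language A} (hL : IsHDT0L L) (g : A → List B) :
    IsHDT0L ((fun w : List A => w.flatMap g) '' L : Language B) := by
  obtain ⟨C, ι, hC, hι, start, tab, out, K, hK, hL⟩ := hL
  refine ⟨C, ι, hC, hι, start, tab, fun c => (out c).flatMap g, K, hK, fun w => ?_⟩
  change (∃ v, v ∈ L ∧ v.flatMap g = w) ↔ _
  simp [hL, List.flatMap_assoc]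

/-- The disjoint union of two tables of substitutions, together with two substitutions, each of
which erases the letters of one side. -/
def sumTab {C₁ C₂ ι₁ ι₂ : Type} (tab₁ : ι₁ → C₁ → List C₁) (tab₂ : ι₂ → C₂ → List C₂) :
    Bool ⊕ ι₁ ⊕ ι₂ → C₁ ⊕ C₂ → List (C₁ ⊕ C₂)
  | .inl b, .inl c => if b then [] else [.inl c]
  | .inl b, .inr c => if b then [.inr c] else []
  | .inr (.inl i), .inl c => (tab₁ i c).map .inl
  | .inr (.inl _), .inr c => [.inr c]
  | .inr (.inr _), .inl c => [.inl c]
  | .inr (.inr i), .inr c => (tab₂ i c).map .inr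

section Sum

variable {C₁ C₂ ι₁ ι₂ : Type} (tab₁ : ι₁ → C₁ → List C₁) (tab₂ : ι₂ → C₂ → List C₂)

theorem iterSub_sumTab_inl_inl (φs : List ι₁) (w : List C₁) :
    iterSub (sumTab tab₁ tab₂) (φs.map (.inr ∘ .inl)) (w.map .inl) =
      (iterSub tab₁ φs w).map .inl :=
  iterSub_map tab₁ (fun _ _ => rfl) φs w

theorem iterSub_sumTab_inr_inr (φs : List ι₂) (w : List C₂) :
    iterSub (sumTab tab₁ tab₂) (φs.map (.inr ∘ .inr)) (w.map .inr) =
      (iterSub tab₂ φs w).map .inr :=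
  iterSub_map tab₂ (fun _ _ => rfl) φs w

theorem iterSub_sumTab_inl_inr (φs : List ι₁) (w : List C₂) :
    iterSub (sumTab tab₁ tab₂) (φs.map (.inr ∘ .inl)) (w.map .inr) = w.map .inr :=
  iterSub_of_forall_fixed _ _ _ (by simp [sumTab])

theorem iterSub_sumTab_inr_inl (φs : List ι₂) (w : List C₁) :
    iterSub (sumTab tab₁ tab₂) (φs.map (.inr ∘ .inr)) (w.map .inl) = w.map .inl :=
  iterSub_of_forall_fixed _ _ _ (by simp [sumTab])

end Sum

theorem IsHDT0L.add {L M : Language A} (hL : IsHDT0L L) (hM : IsHDT0L M) :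
    IsHDT0L (L + M) := by
  obtain ⟨C₁, ι₁, _, _, start₁, tab₁, out₁, K₁, hK₁, hL⟩ := hL
  obtain ⟨C₂, ι₂, _, _, start₂, tab₂, out₂, K₂, hK₂, hM⟩ := hM
  refine ⟨C₁ ⊕ C₂, Bool ⊕ ι₁ ⊕ ι₂, inferInstance, inferInstance,
    start₁.map .inl ++ start₂.map .inr, sumTab tab₁ tab₂, Sum.elim out₁ out₂,
    {[.inl false]} * Language.map (.inr ∘ .inl) K₁ +
      {[.inl true]} * Language.map (.inr ∘ .inr) K₂,
    .add
      (IsRegular.mul (isRegular_singleton_singleton _)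
        (IsRegular.map_of_injective (Sum.inr_injective.comp Sum.inl_injective) hK₁))
      (IsRegular.mul (isRegular_singleton_singleton _)
        (IsRegular.map_of_injective (Sum.inr_injective.comp Sum.inr_injective) hK₂)),
    fun w => ?_⟩
  have h₁ (φs : List ι₁) : (iterSub (sumTab tab₁ tab₂) ([.inl false] ++ φs.map (.inr ∘ .inl))
      (start₁.map .inl ++ start₂.map .inr)).flatMap (Sum.elim out₁ out₂) =
      (iterSub tab₁ φs start₁).flatMap out₁ := by
    have : (start₁.map Sum.inl ++ start₂.map Sum.inr).flatMap (sumTab tab₁ tab₂ (.inl false)) =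
        start₁.map .inl := by
      simp [List.map_eq_flatMap, List.flatMap_assoc, sumTab]
    rw [List.singleton_append, iterSub_cons, this, iterSub_sumTab_inl_inl]
    simp [List.flatMap_map]
  have h₂ (φs : List ι₂) : (iterSub (sumTab tab₁ tab₂) ([.inl true] ++ φs.map (.inr ∘ .inr))
      (start₁.map .inl ++ start₂.map .inr)).flatMap (Sum.elim out₁ out₂) =
      (iterSub tab₂ φs start₂).flatMap out₂ := by
    have : (start₁.map Sum.inl ++ start₂.map Sum.inr).flatMap (sumTab tab₁ tab₂ (.inl true)) =
        start₂.map .inr := by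
      simp [List.map_eq_flatMap, List.flatMap_assoc, sumTab]
    rw [List.singleton_append, iterSub_cons, this, iterSub_sumTab_inr_inr]
    simp [List.flatMap_map]
  rw [Language.mem_add, hL, hM]
  constructor
  · rintro (⟨φs, h, rfl⟩ | ⟨φs, h, rfl⟩)
    · exact ⟨_, .inl ⟨_, rfl, _, ⟨φs, h, rfl⟩, rfl⟩, h₁ φs⟩
    · exact ⟨_, .inr ⟨_, rfl, _, ⟨φs, h, rfl⟩, rfl⟩, h₂ φs⟩
  · rintro ⟨_, ⟨_, rfl, _, ⟨φs, h, rfl⟩, rfl⟩ | ⟨_, rfl, _, ⟨φs, h, rfl⟩, rfl⟩, rfl⟩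
    · exact .inl ⟨φs, h, (h₁ φs).symm⟩
    · exact .inr ⟨φs, h, (h₂ φs).symm⟩

theorem IsHDT0L.mul {L M : Language A} (hL : IsHDT0L L) (hM : IsHDT0L M) :
    IsHDT0L (L * M) := by
  obtain ⟨C₁, ι₁, _, _, start₁, tab₁, out₁, K₁, hK₁, hL⟩ := hL
  obtain ⟨C₂, ι₂, _, _, start₂, tab₂, out₂, K₂, hK₂, hM⟩ := hM
  refine ⟨C₁ ⊕ C₂, Bool ⊕ ι₁ ⊕ ι₂, inferInstance, inferInstance,
    start₁.map .inl ++ start₂.map .inr, sumTab tab₁ tab₂, Sum.elim out₁ out₂,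
    Language.map (.inr ∘ .inl) K₁ * Language.map (.inr ∘ .inr) K₂,
    IsRegular.mul
      (IsRegular.map_of_injective (Sum.inr_injective.comp Sum.inl_injective) hK₁)
      (IsRegular.map_of_injective (Sum.inr_injective.comp Sum.inr_injective) hK₂),
    fun w => ?_⟩
  have h (φs : List ι₁) (ψs : List ι₂) :
      (iterSub (sumTab tab₁ tab₂) (φs.map (.inr ∘ .inl) ++ ψs.map (.inr ∘ .inr))
        (start₁.map .inl ++ start₂.map .inr)).flatMap (Sum.elim out₁ out₂) =
      (iterSub tab₁ φs start₁).flatMap out₁ ++ (iterSub tab₂ ψs start₂).flatMap out₂ := by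
    rw [iterSub_append, iterSub_word_append, iterSub_word_append, iterSub_sumTab_inl_inl,
      iterSub_sumTab_inl_inr, iterSub_sumTab_inr_inl, iterSub_sumTab_inr_inr]
    simp [List.flatMap_map]
  rw [Language.mem_mul]
  constructor
  · rintro ⟨a, ha, b, hb, rfl⟩
    obtain ⟨φs, hφs, rfl⟩ := (hL a).1 ha
    obtain ⟨ψs, hψs, rfl⟩ := (hM b).1 hb
    exact ⟨_, ⟨_, ⟨φs, hφs, rfl⟩, _, ⟨ψs, hψs, rfl⟩, rfl⟩, h φs ψs⟩
  · rintro ⟨_, ⟨_, ⟨φs, hφs, rfl⟩, _, ⟨ψs, hψs, rfl⟩, rfl⟩, rfl⟩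
    exact ⟨_, (hL _).2 ⟨φs, hφs, rfl⟩, _, (hM _).2 ⟨ψs, hψs, rfl⟩, (h φs ψs).symm⟩

/-- The table of a system for the Kleene star: the substitution `none` turns the letters of the
current round into their output and uses the letter `none` to begin another round. -/
def starTab {C ι : Type} (start : List C) (tab : ι → C → List C) (out : C → List A) :
    Option ι → Option (C ⊕ A) → List (Option (C ⊕ A))
  | none, none => start.map (some ∘ .inl) ++ [none]
  | none, some (.inl c) => (out c).map (some ∘ .inr)
  | some i, some (.inl c) => (tab i c).map (some ∘ .inl)
  | some _, none => [none]
  | _, some (.inr a) => [some (.inr a)]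

/-- The output of the letters of a system for the Kleene star. -/
def starOut {C : Type} (out : C → List A) : Option (C ⊕ A) → List A
  | none => []
  | some (.inl c) => out c
  | some (.inr a) => [a]

theorem flatMap_starOut_iterSub_starTab {C ι : Type} (start : List C) (tab : ι → C → List C)
    (out : C → List A) (φss : List (List ι)) :
    (iterSub (starTab start tab out) (φss.map fun φs => none :: φs.map some).flatten
        [none]).flatMap (starOut out) =
      (φss.map fun φs => (iterSub tab φs start).flatMap out).flatten := by
  have hout (φss : List (List ι)) (v : List C) :
      (iterSub (starTab start tab out) (φss.map fun φs => none :: φs.map some).flatten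
        (v.map (some ∘ .inl))).flatMap (starOut out) = v.flatMap out := by
    cases φss with
    | nil => simp [List.flatMap_map, starOut]
    | cons φs φss =>
      have : (v.map (some ∘ .inl)).flatMap (starTab start tab out none) =
          (v.flatMap out).map (some ∘ .inr) := by
        simp [List.flatMap_map, List.map_flatMap, starTab]
      rw [List.map_cons, List.flatten_cons, List.cons_append, iterSub_cons, this,
        iterSub_of_forall_fixed]
      · simp [List.flatMap_map, starOut]
      · intro i _ c hc
        obtain ⟨a, -, rfl⟩ := List.mem_map.1 hc
        cases i <;> rfl
  induction φss with
  | nil => simp [starOut]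
  | cons φs φss ih =>
    have hstart : [none].flatMap (starTab start tab out none) =
        start.map (some ∘ .inl) ++ [none] := by
      simp [starTab]
    rw [List.map_cons, List.flatten_cons, List.cons_append, iterSub_cons, hstart, iterSub_append,
      iterSub_word_append, iterSub_map tab (fun _ _ => rfl),
      iterSub_of_forall_fixed _ (φs.map some) [none] (by simp [starTab]),
      iterSub_word_append, List.flatMap_append, hout, ih, List.map_cons, List.flatten_cons]

theorem IsHDT0L.kstar [Finite A] {L : Language A} (hL : IsHDT0L L) :
    IsHDT0L (KStar.kstar L) := by
  obtain ⟨C, ι, _, _, start, tab, out, K, hK, hL⟩ := hL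
  refine ⟨Option (C ⊕ A), Option ι, inferInstance, inferInstance, [none],
    starTab start tab out, starOut out, KStar.kstar ({[none]} * Language.map some K),
    IsRegular.kstar (IsRegular.mul (isRegular_singleton_singleton _)
      (IsRegular.map_of_injective (Option.some_injective _) hK)), fun w => ?_⟩
  rw [Language.mem_kstar]
  constructor
  · rintro ⟨ws, rfl, hws⟩
    choose f hfK hf using fun w : {w // w ∈ ws} => (hL w).1 (hws w w.2)
    refine ⟨((ws.attach.map f).map fun φs => none :: φs.map some).flatten,
      Language.join_mem_kstar ?_, ?_⟩
    · simp only [List.mem_map]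
      rintro _ ⟨_, ⟨v, -, rfl⟩, rfl⟩
      exact ⟨_, rfl, _, ⟨_, hfK v, rfl⟩, rfl⟩
    · rw [flatMap_starOut_iterSub_starTab, List.map_map]
      simp [Function.comp_def, hf]
  · rintro ⟨_, hφs, rfl⟩
    obtain ⟨ys, rfl, hys⟩ := Language.mem_kstar.1 hφs
    have : ∃ φss : List (List ι), (∀ φs ∈ φss, φs ∈ K) ∧
        φss.map (fun φs => none :: φs.map some) = ys := by
      clear hφs
      induction ys with
      | nil => exact ⟨[], by simp⟩
      | cons y ys ih =>
        obtain ⟨φss, h, rfl⟩ := ih fun z hz => hys z (by simp [hz])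
        obtain ⟨_, rfl, _, ⟨φs, hφs, rfl⟩, rfl⟩ := hys y (by simp)
        exact ⟨φs :: φss, by simpa using ⟨hφs, h⟩, rfl⟩
    obtain ⟨φss, h, rfl⟩ := this
    refine ⟨_, flatMap_starOut_iterSub_starTab start tab out φss, ?_⟩
    simp only [List.mem_map]
    rintro _ ⟨φs, hφs, rfl⟩
    exact (hL _).2 ⟨φs, h φs hφs, rfl⟩

end Closure

theorem toList_map_ofList_eq_flatMap {A B : Type} (φ : FreeMonoid A →* FreeMonoid B)
    (w : List A) :
    FreeMonoid.toList (φ (FreeMonoid.ofList w)) =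
      w.flatMap fun a => FreeMonoid.toList (φ (FreeMonoid.of a)) := by
  induction w with
  | nil => simp
  | cons a w ih => simp [FreeMonoid.ofList_cons, FreeMonoid.toList_mul, ih]

/-- The class of EDT0L languages is closed under finite unions,
intersection with regular languages, concatenation, Kleene star, and images under
free monoid homomorphisms. -/
theorem edt0l_closure_properties {α β : Type} [Fintype α] [Fintype β]
    (L M R : Language α) (φ : FreeMonoid α →* FreeMonoid β)
    (hL : IsEDT0L L) (hM : IsEDT0L M) (hR : R.IsRegular) :
    IsEDT0L (L + M) ∧
    IsEDT0L ({w | w ∈ L ∧ w ∈ R} : Language α) ∧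
    IsEDT0L (L * M) ∧
    IsEDT0L (KStar.kstar L) ∧
    IsEDT0L ((fun w : List α => FreeMonoid.toList (φ (FreeMonoid.ofList w))) '' L :
      Language β) := by
  refine ⟨(hL.isHDT0L.add hM.isHDT0L).isEDT0L, (hL.isHDT0L.inter hR).isEDT0L,
    (hL.isHDT0L.mul hM.isHDT0L).isEDT0L, hL.isHDT0L.kstar.isEDT0L, ?_⟩
  simp only [toList_map_ofList_eq_flatMap]
  exact (hL.isHDT0L.image_flatMap _).isEDT0L

end Paper
end

section
/- Let n be a positive integer, let Δ be a finite alphabet, let #, #₁, …, #ₙ be distinct symbols not in Δ, and let A be a set of n-tuples of words over Δ. Define L = {w₁ # w₂ # ⋯ # wₙ : (w₁, …, wₙ) ∈ A}, a language over Δ ∪ {#}, and M = {w₁ #₁ w₂ #₂ ⋯ #ₙ₋₁ wₙ #ₙ : (w₁, …, wₙ) ∈ A}, a language over Δ ∪ {#₁, …, #ₙ}. Then L is EDT0L if and only if M is EDT0L. -/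
namespace Paper

section ControlShape

variable {ι κ τ σ : Type}

/-- The words `a m₁ ⋯ mₖ z` with an initial letter `a : κ`, middle letters `m₁, …, mₖ : τ` whose
image under `f` is a word of `R`, and the end marker `z`. -/
def framed (f : τ → ι) (R : Language ι) : Language (κ ⊕ τ ⊕ Unit) :=
  { l | ∃ (a : κ) (xs : List τ), xs.map f ∈ R ∧
      l = Sum.inl a :: (xs.map (fun x => Sum.inr (Sum.inl x)) ++ [Sum.inr (Sum.inr ())]) }

/-- An automaton for `framed f M.accepts`: the states `0`, `1`, `2` of `Fin 3` are the start
state, the accepting state and the failure state. -/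
noncomputable def framedDFA (f : τ → ι) (M : DFA ι σ) : DFA (κ ⊕ τ ⊕ Unit) (σ ⊕ Fin 3) where
  step
    | .inr 0, .inl _ => .inl M.start
    | .inl s, .inr (.inl x) => .inl (M.step s (f x))
    | .inl s, .inr (.inr _) => open Classical in if s ∈ M.accept then .inr 1 else .inr 2
    | _, _ => .inr 2
  start := .inr 0
  accept := {.inr 1}

theorem framedDFA_evalFrom_fail (f : τ → ι) (M : DFA ι σ) (l : List (κ ⊕ τ ⊕ Unit)) :
    (framedDFA f M).evalFrom (.inr 2) l = .inr 2 := by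
  induction l with
  | nil => rfl
  | cons x l ih => exact ih

theorem framedDFA_evalFrom_done (f : τ → ι) (M : DFA ι σ) (l : List (κ ⊕ τ ⊕ Unit)) :
    (framedDFA f M).evalFrom (.inr 1) l = .inr 1 ↔ l = [] := by
  cases l with
  | nil => simp
  | cons x l =>
    have := framedDFA_evalFrom_fail f M l
    have h : (framedDFA f M).evalFrom (.inr 1) (x :: l) = .inr 2 := this
    simp [h]

theorem framedDFA_evalFrom_inl (f : τ → ι) (M : DFA ι σ) (s : σ) (l : List (κ ⊕ τ ⊕ Unit)) :
    (framedDFA f M).evalFrom (.inl s) l = .inr 1 ↔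
      ∃ xs : List τ, M.evalFrom s (xs.map f) ∈ M.accept ∧
        l = xs.map (fun x => Sum.inr (Sum.inl x)) ++ [Sum.inr (Sum.inr ())] := by
  induction l generalizing s with
  | nil => simp
  | cons x l ih =>
    rw [DFA.evalFrom_cons]
    rcases x with a | x | u
    · have h : (framedDFA f M).step (.inl s) (.inl a) = .inr 2 := rfl
      rw [h, framedDFA_evalFrom_fail]
      simp only [Sum.inr.injEq, Fin.reduceEq, false_iff, not_exists, not_and]
      rintro (_ | ⟨y, xs⟩) _ <;> simp
    · have h : (framedDFA f M : DFA (κ ⊕ τ ⊕ Unit) _).step (.inl s) (.inr (.inl x)) =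
        .inl (M.step s (f x)) := rfl
      rw [h, ih]
      constructor
      · rintro ⟨xs, hxs, rfl⟩
        exact ⟨x :: xs, hxs, rfl⟩
      · rintro ⟨_ | ⟨y, xs⟩, hxs, he⟩
        · simp at he
        · simp only [List.map_cons, List.cons_append, List.cons.injEq, Sum.inr.injEq,
            Sum.inl.injEq] at he
          obtain ⟨rfl, rfl⟩ := he
          exact ⟨xs, hxs, rfl⟩
    · by_cases hs : s ∈ M.accept
      · have h : (framedDFA f M : DFA (κ ⊕ τ ⊕ Unit) _).step (.inl s) (.inr (.inr u)) =
          .inr 1 := if_pos hs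
        rw [h, framedDFA_evalFrom_done]
        constructor
        · rintro rfl
          exact ⟨[], hs, rfl⟩
        · rintro ⟨_ | ⟨y, xs⟩, -, he⟩ <;> simp_all
      · have h : (framedDFA f M : DFA (κ ⊕ τ ⊕ Unit) _).step (.inl s) (.inr (.inr u)) =
          .inr 2 := if_neg hs
        rw [h, framedDFA_evalFrom_fail]
        simp only [Sum.inr.injEq, Fin.reduceEq, false_iff, not_exists, not_and]
        rintro (_ | ⟨y, xs⟩) hy
        · exact absurd hy hs
        · simp

theorem framed_isRegular (f : τ → ι) {R : Language ι} (hR : R.IsRegular) :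
    (framed f R : Language (κ ⊕ τ ⊕ Unit)).IsRegular := by
  obtain ⟨σ, _, M, rfl⟩ := hR
  refine ⟨σ ⊕ Fin 3, inferInstance, framedDFA f M, ?_⟩
  ext l
  change (framedDFA f M).evalFrom (.inr 0) l = .inr 1 ↔ _
  cases l with
  | nil =>
    simp only [DFA.evalFrom_nil, Sum.inr.injEq, Fin.reduceEq, false_iff]
    rintro ⟨a, xs, -, h⟩
    cases h
  | cons x l =>
    rw [DFA.evalFrom_cons]
    rcases x with a | x
    · refine (framedDFA_evalFrom_inl f M M.start l).trans ?_
      constructor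
      · rintro ⟨xs, h, rfl⟩
        exact ⟨a, xs, h, rfl⟩
      · rintro ⟨b, xs, h, he⟩
        exact ⟨xs, h, (List.cons.inj he).2⟩
    · have h : (framedDFA f M : DFA (κ ⊕ τ ⊕ Unit) _).step (.inr 0) (.inr x) = .inr 2 := rfl
      rw [h, framedDFA_evalFrom_fail]
      simp only [Sum.inr.injEq, Fin.reduceEq, false_iff]
      rintro ⟨a, xs, -, h⟩
      cases h

end ControlShape

section Substitution

variable {C : Type*}

@[simp] theorem subApply_nil (f : C → List C) : subApply f [] = [] := rfl

@[simp] theorem subApply_cons (f : C → List C) (c : C) (w : List C) :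
    subApply f (c :: w) = f c ++ subApply f w := rfl

@[simp] theorem subApply_append (f : C → List C) (u w : List C) :
    subApply f (u ++ w) = subApply f u ++ subApply f w := by
  simp [subApply]

theorem subApply_eq_self {f : C → List C} {w : List C} (h : ∀ c ∈ w, f c = [c]) :
    subApply f w = w := by
  induction w with
  | nil => rfl
  | cons c w ih => simp_all

theorem mem_subApply {f : C → List C} {w : List C} {d : C} :
    d ∈ subApply f w ↔ ∃ c ∈ w, d ∈ f c := by
  simp [subApply]

end Substitution

/-- The output of a sequential transducer whose states form a monoid `G`: reading the letter `a`
in the state `p` produces `out p a` and moves to the state `p + h a`. -/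
def transduce {α β G : Type*} [Add G] (h : α → G) (out : G → α → List β) : G → List α → List β
  | _, [] => []
  | p, a :: w => out p a ++ transduce h out (p + h a) w

/-- Label every letter of a word with the total weight before it and with its own weight. -/
def annotate {C G : Type*} [Add G] (m : C → G) : G → List C → List (G × C × G)
  | _, [] => []
  | p, c :: w => (p, c, m c) :: annotate m (p + m c) w

theorem annotate_append {C G : Type*} [AddMonoid G] (m : C → G) (p : G) (u w : List C) :
    annotate m p (u ++ w) = annotate m p u ++ annotate m (p + (u.map m).sum) w := by
  induction u generalizing p with
  | nil => simp [annotate]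
  | cons a u ih => simp [annotate, ih, add_assoc]

theorem exists_mem_annotate {C G : Type*} [Add G] (m : C → G) (p : G) {w : List C} {c : C}
    (hc : c ∈ w) : ∃ q, (q, c, m c) ∈ annotate m p w := by
  induction w generalizing p with
  | nil => simp at hc
  | cons d w ih =>
    rcases List.mem_cons.1 hc with rfl | hc
    · exact ⟨p, by simp [annotate]⟩
    · obtain ⟨q, hq⟩ := ih (p + m d) hc
      exact ⟨q, by simp [annotate, hq]⟩

namespace EDT0LSystem

section Transducer

variable {α β G : Type} [AddMonoid G]

/-- Letters of the transduced system: a start symbol `inl none`, annotated letters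
`inl (some (p, c, k))`, terminals `inr (some b)` and a failure symbol `inr none`. -/
abbrev TransduceLetter (S : EDT0LSystem α) (β G : Type) : Type :=
  Option (G × S.C × G) ⊕ Option β

/-- Substitutions of the transduced system: guess the weights of the letters of the start word,
apply a substitution of `S` and guess the weights of the resulting letters, produce the output. -/
abbrev TransduceIndex (S : EDT0LSystem α) (G : Type) : Type :=
  (S.C → G) ⊕ (S.ι × (S.C → G)) ⊕ Unit

open Classical in
/-- The substitutions of the transduced system; wrong guesses produce the failure symbol. -/
noncomputable def transduceTab (S : EDT0LSystem α) (h : α → G) (out : G → α → List β)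
    (v : List β) : S.TransduceIndex G → S.TransduceLetter β G → List (S.TransduceLetter β G)
  | .inl m, .inl none =>
      (annotate m 0 S.start).map (fun x => .inl (some x)) ++ v.map (fun b => .inr (some b))
  | .inr (.inl (i, m)), .inl (some (p, c, k)) =>
      if ((S.tab i c).map m).sum = k then
        (annotate m p (S.tab i c)).map (fun x => .inl (some x))
      else [.inr none]
  | .inr (.inr _), .inl (some (p, c, k)) =>
      match S.term c with
      | some a => if h a = k then (out p a).map (fun b => .inr (some b)) else [.inr none]
      | none => [.inr none]
  | _, x => [x]

/-- The system accepting the image of the language of `S` under a transducer, followed by `v`. -/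
noncomputable def transduced (S : EDT0LSystem α) [Finite G] [Finite β] (h : α → G)
    (out : G → α → List β) (v : List β) : EDT0LSystem β where
  C := S.TransduceLetter β G
  finC := by
    have := S.finC
    exact Fintype.ofFinite _
  term := Sum.elim (fun _ => none) id
  term_inj := by
    rintro (c | c) (c' | c') a <;> simp_all
  start := [.inl none]
  ι := S.TransduceIndex G
  finι := by
    have := S.finC
    have := S.finι
    exact Fintype.ofFinite _
  tab := S.transduceTab h out v
  control := framed Prod.fst S.control
  control_reg := framed_isRegular _ S.control_reg

/-- An annotated word of the transduced system, followed by the fixed suffix `v`. -/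
def annotated (S : EDT0LSystem α) (v : List β) (m : S.C → G) (p : G) (w : List S.C) :
    List (S.TransduceLetter β G) :=
  (annotate m p w).map (fun x => .inl (some x)) ++ v.map (fun b => .inr (some b))

variable (S : EDT0LSystem α) (h : α → G) (out : G → α → List β) (v : List β)

theorem subApply_transduceTab_terminal (j : S.TransduceIndex G) (u : List β) :
    subApply (S.transduceTab h out v j) (u.map (fun b => .inr (some b))) =
      u.map (fun b => .inr (some b)) := by
  refine subApply_eq_self fun c hc => ?_
  obtain ⟨b, -, rfl⟩ := List.mem_map.1 hc
  rcases j with m | ⟨i, m⟩ | _ <;> rfl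

theorem fail_mem_subApply (j : S.TransduceIndex G) {w : List (S.TransduceLetter β G)}
    (hw : .inr none ∈ w) : .inr none ∈ subApply (S.transduceTab h out v j) w := by
  refine mem_subApply.2 ⟨_, hw, ?_⟩
  rcases j with m | ⟨i, m⟩ | _ <;> simp [transduceTab]

theorem fail_mem_foldl (l : List (S.TransduceIndex G)) {w : List (S.TransduceLetter β G)}
    (hw : .inr none ∈ w) :
    .inr none ∈ l.foldl (fun x j => subApply (S.transduceTab h out v j) x) w := by
  induction l generalizing w with
  | nil => exact hw
  | cons j l ih => exact ih (fail_mem_subApply S h out v j hw)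

theorem subApply_step {i : S.ι} {m m' : S.C → G} {w : List S.C}
    (hw : ∀ c ∈ w, ((S.tab i c).map m').sum = m c) (p : G) :
    subApply (S.transduceTab h out v (.inr (.inl (i, m')))) (S.annotated v m p w) =
      S.annotated v m' p (subApply (S.tab i) w) := by
  rw [annotated, subApply_append, subApply_transduceTab_terminal, annotated]
  congr 1
  induction w generalizing p with
  | nil => rfl
  | cons c w ih =>
    have hc : ((S.tab i c).map m').sum = m c := hw c (by simp)
    simp [annotate, annotate_append, transduceTab, hc,
      ih (fun d hd => hw d (List.mem_cons_of_mem _ hd))]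

theorem fail_mem_step {i : S.ι} {m m' : S.C → G} {w : List S.C}
    (hw : ¬ ∀ c ∈ w, ((S.tab i c).map m').sum = m c) (p : G) :
    .inr none ∈
      subApply (S.transduceTab h out v (.inr (.inl (i, m')))) (S.annotated v m p w) := by
  push Not at hw
  obtain ⟨c, hc, hne⟩ := hw
  obtain ⟨q, hq⟩ := exists_mem_annotate m p hc
  refine mem_subApply.2 ⟨.inl (some (q, c, m c)), ?_, ?_⟩
  · simp [annotated, hq]
  · simp [transduceTab, hne]

theorem subApply_finish {m : S.C → G} {w : List S.C} {u : List α}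
    (hu : w.map S.term = u.map some) (hw : ∀ c ∈ w, ∀ a, S.term c = some a → h a = m c) (p : G) :
    subApply (S.transduceTab h out v (.inr (.inr ()))) (S.annotated v m p w) =
      (transduce h out p u ++ v).map (fun b => .inr (some b)) := by
  rw [annotated, subApply_append, subApply_transduceTab_terminal, List.map_append]
  congr 1
  induction w generalizing p u with
  | nil =>
    obtain rfl : u = [] := by simpa using hu.symm
    rfl
  | cons c w ih =>
    cases u with
    | nil => simp at hu
    | cons a u =>
      simp only [List.map_cons, List.cons.injEq] at hu
      have hc : h a = m c := hw c (by simp) a hu.1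
      simp [annotate, transduce, transduceTab, hu.1, hc,
        ih hu.2 (fun d hd => hw d (List.mem_cons_of_mem _ hd))]

theorem fail_mem_finish {m : S.C → G} {w : List S.C}
    (hw : ¬ ∀ c ∈ w, ∃ a, S.term c = some a ∧ h a = m c) (p : G) :
    .inr none ∈ subApply (S.transduceTab h out v (.inr (.inr ()))) (S.annotated v m p w) := by
  push Not at hw
  obtain ⟨c, hc, hne⟩ := hw
  obtain ⟨q, hq⟩ := exists_mem_annotate m p hc
  refine mem_subApply.2 ⟨.inl (some (q, c, m c)), ?_, ?_⟩
  · simp [annotated, hq]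
  · cases hS : S.term c with
    | none => simp [transduceTab, hS]
    | some a => simp [transduceTab, hS, hne a hS]

/-- The effect of the substitutions of the transduced system after the initial guess. -/
noncomputable def continuation (xs : List (S.ι × (S.C → G)))
    (w : List (S.TransduceLetter β G)) : List (S.TransduceLetter β G) :=
  (xs.map (fun x => Sum.inr (Sum.inl x)) ++ [Sum.inr (Sum.inr ())]).foldl
    (fun x j => subApply (S.transduceTab h out v j) x) w

theorem exists_of_continuation (xs : List (S.ι × (S.C → G))) (m : S.C → G) (p : G)
    (w : List S.C) (hd : .inr none ∉ S.continuation h out v xs (S.annotated v m p w)) :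
    ∃ u : List α, (S.apply (xs.map Prod.fst) w).map S.term = u.map some ∧
      S.continuation h out v xs (S.annotated v m p w) =
        (transduce h out p u ++ v).map (fun b => .inr (some b)) := by
  induction xs generalizing m w with
  | nil =>
    by_cases hw : ∀ c ∈ w, ∃ a, S.term c = some a ∧ h a = m c
    · have : ∃ u : List α, w.map S.term = u.map some := by
        clear hd
        induction w with
        | nil => exact ⟨[], rfl⟩
        | cons c w ih =>
          obtain ⟨u, hu⟩ := ih fun d hd => hw d (List.mem_cons_of_mem _ hd)
          obtain ⟨a, ha, -⟩ := hw c (by simp)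
          exact ⟨a :: u, by simp [hu, ha]⟩
      obtain ⟨u, hu⟩ := this
      refine ⟨u, hu, subApply_finish S h out v hu (fun c hc a ha => ?_) p⟩
      obtain ⟨a', ha', he⟩ := hw c hc
      rw [ha] at ha'
      exact Option.some.inj ha' ▸ he
    · exact absurd (fail_mem_finish S h out v hw p) hd
  | cons x xs ih =>
    obtain ⟨i, m'⟩ := x
    by_cases hw : ∀ c ∈ w, ((S.tab i c).map m').sum = m c
    · have he : S.continuation h out v ((i, m') :: xs) (S.annotated v m p w) =
          S.continuation h out v xs (S.annotated v m' p (subApply (S.tab i) w)) := by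
        rw [← subApply_step S h out v hw p]
        rfl
      rw [he] at hd ⊢
      exact ih m' _ hd
    · exact absurd (fail_mem_foldl S h out v _ (fail_mem_step S h out v hw p)) hd

theorem exists_continuation (φs : List S.ι) (w : List S.C) {u : List α}
    (hu : (S.apply φs w).map S.term = u.map some) :
    ∃ (m : S.C → G) (xs : List (S.ι × (S.C → G))), xs.map Prod.fst = φs ∧
      ∀ p, S.continuation h out v xs (S.annotated v m p w) =
        (transduce h out p u ++ v).map (fun b => .inr (some b)) := by
  induction φs generalizing w with
  | nil =>
    refine ⟨fun c => (S.term c).elim 0 h, [], rfl, fun p => ?_⟩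
    exact subApply_finish S h out v hu (fun c _ a ha => by simp [ha]) p
  | cons i φs ih =>
    obtain ⟨m', xs, hxs, he⟩ := ih (subApply (S.tab i) w) hu
    refine ⟨fun c => ((S.tab i c).map m').sum, (i, m') :: xs, by simp [hxs], fun p => ?_⟩
    rw [← he p, ← subApply_step S h out v (m := fun c => ((S.tab i c).map m').sum)
      (fun _ _ => rfl) p]
    rfl

theorem transduced_accepts [Finite G] [Finite β] :
    (S.transduced h out v).accepts =
      ({ l | ∃ u ∈ S.accepts, l = transduce h out 0 u ++ v } : Language β) := by
  let term : S.TransduceLetter β G → Option β := Sum.elim (fun _ => none) id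
  have key (m : S.C → G) (xs : List (S.ι × (S.C → G))) :
      ((S.transduced h out v).apply (Sum.inl m ::
        (xs.map (fun x => Sum.inr (Sum.inl x)) ++ [Sum.inr (Sum.inr ())]))
        (S.transduced h out v).start).map (S.transduced h out v).term =
      (S.continuation h out v xs (S.annotated v m 0 S.start)).map term := by
    rw [← List.append_nil (S.annotated v m 0 S.start)]
    rfl
  have term_some (u : List β) : (u.map (fun b => .inr (some b))).map term = u.map some := by
    rw [List.map_map]
    rfl
  ext l
  constructor
  · rintro ⟨_, ⟨m, xs, hxs, rfl⟩, hl⟩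
    replace hl := (key m xs).symm.trans hl
    have hd : .inr none ∉ S.continuation h out v xs (S.annotated v m 0 S.start) := by
      intro hd
      have := List.mem_map_of_mem (f := term) hd
      rw [hl] at this
      obtain ⟨b, -, hb⟩ := List.mem_map.1 this
      cases hb
    obtain ⟨u, hu, he⟩ := S.exists_of_continuation h out v xs m 0 S.start hd
    refine ⟨u, ⟨_, hxs, hu⟩, ?_⟩
    rw [he, term_some] at hl
    exact (List.map_injective_iff.2 (Option.some_injective β) hl).symm
  · rintro ⟨u, ⟨φs, hφs, hu⟩, rfl⟩
    obtain ⟨m, xs, hxs, he⟩ := S.exists_continuation h out v φs S.start hu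
    refine ⟨_, ⟨m, xs, hxs ▸ hφs, rfl⟩, (key m xs).trans ?_⟩
    rw [he, term_some]

end Transducer

end EDT0LSystem

/-- EDT0L languages are closed under sequential transducers whose states form a finite monoid,
and under appending a fixed word. -/
theorem IsEDT0L.transduce {α β G : Type} [AddMonoid G] [Finite G] [Finite β] {L : Language α}
    (hL : IsEDT0L L) (h : α → G) (out : G → α → List β) (v : List β) :
    IsEDT0L ({ l | ∃ u ∈ L, l = transduce h out 0 u ++ v } : Language β) := by
  obtain ⟨S, rfl⟩ := hL
  exact ⟨S.transduced h out v, S.transduced_accepts h out v⟩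

section Hashes

variable {Δ : Type}

theorem transduce_map_inl {γ δ G : Type*} [AddMonoid G] (h : Δ ⊕ γ → G)
    (out : G → Δ ⊕ γ → List (Δ ⊕ δ)) (hh : ∀ d, h (.inl d) = 0)
    (hout : ∀ p d, out p (.inl d) = [.inl d]) (p : G) (w : List Δ) (l : List (Δ ⊕ γ)) :
    transduce h out p (w.map Sum.inl ++ l) = w.map Sum.inl ++ transduce h out p l := by
  induction w with
  | nil => rfl
  | cons d w ih => simp [transduce, hh, hout, ih]

theorem transduce_single_hash {γ G : Type*} [AddMonoid G] (h : Δ ⊕ Unit → G)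
    (out : G → Δ ⊕ Unit → List (Δ ⊕ γ)) (r : G → γ) (hh : ∀ d, h (.inl d) = 0)
    (hout : ∀ p d, out p (.inl d) = [.inl d]) (hout' : ∀ p u, out p (.inr u) = [.inr (r p)])
    (k : ℕ) (w : Fin (k + 1) → List Δ) (f : Fin (k + 1) → G)
    (hf : ∀ i : Fin k, f i.succ = f i.castSucc + h (.inr ())) :
    transduce h out (f 0)
        (List.intercalate [Sum.inr ()] (List.ofFn fun i => (w i).map Sum.inl)) ++
        [Sum.inr (r (f (Fin.last k)))] =
      (List.ofFn fun i => (w i).map Sum.inl ++ [Sum.inr (r (f i))]).flatten := by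
  induction k with
  | zero =>
    have := transduce_map_inl h out hh hout (f 0) (w 0) []
    simp only [List.append_nil] at this
    simp [this, transduce]
  | succ k ih =>
    have ih := ih (fun i => w i.succ) (fun i => f i.succ) (fun i => hf i.succ)
    have h0 : f (Fin.succ 0) = f 0 + h (.inr ()) := hf 0
    rw [List.ofFn_succ (n := k + 1), List.intercalate_cons_of_ne_nil (by simp), List.append_assoc,
      transduce_map_inl h out hh hout, List.ofFn_succ (n := k + 1), List.flatten_cons, ← ih]
    simp [transduce, hout', ← h0]

theorem transduce_different_hashes {γ G : Type*} [AddMonoid G] (h : Δ ⊕ γ → G)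
    (out : G → Δ ⊕ γ → List (Δ ⊕ Unit)) (z : γ) (hh : ∀ x, h x = 0)
    (hout : ∀ p d, out p (.inl d) = [.inl d]) (hz : ∀ p, out p (.inr z) = [])
    (hout' : ∀ p c, c ≠ z → out p (.inr c) = [.inr ()])
    (k : ℕ) (w : Fin (k + 1) → List Δ) (f : Fin (k + 1) → γ)
    (hf : ∀ i, f i = z ↔ i = Fin.last k) (p : G) :
    transduce h out p (List.ofFn fun i => (w i).map Sum.inl ++ [Sum.inr (f i)]).flatten =
      List.intercalate [Sum.inr ()] (List.ofFn fun i => (w i).map Sum.inl) := by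
  induction k with
  | zero =>
    have h0 : f 0 = z := (hf 0).2 rfl
    simp [transduce_map_inl h out (fun d => hh _) hout, transduce, h0, hz]
  | succ k ih =>
    have ih := ih (fun i => w i.succ) (fun i => f i.succ) (fun i => by
      rw [hf, ← Fin.succ_last, Fin.succ_inj])
    have h0 : f 0 ≠ z := fun h0 => by simpa [Fin.ext_iff] using (hf 0).1 h0
    rw [List.ofFn_succ (n := k + 1), List.flatten_cons, List.append_assoc,
      transduce_map_inl h out (fun d => hh _) hout, List.ofFn_succ (n := k + 1),
      List.intercalate_cons_of_ne_nil (by simp), ← ih]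
    simp [transduce, hout' _ _ h0, hh]

end Hashes

/-- For a set `A` of `n`-tuples of words over `Δ`, the language
`{w₁ # w₂ # ⋯ # wₙ : (w₁,…,wₙ) ∈ A}` (one separator symbol `#`) is EDT0L if and only if
the language `{w₁ #₁ w₂ #₂ ⋯ wₙ #ₙ : (w₁,…,wₙ) ∈ A}` (distinct separators `#₁,…,#ₙ`,
modelled as the elements of `Fin n`) is EDT0L. -/
theorem edt0l_different_hashes {Δ : Type} [Fintype Δ] (n : ℕ) (hn : 0 < n)
    (A : Set (Fin n → List Δ)) :
    IsEDT0L ({ l : List (Δ ⊕ Unit) | ∃ w ∈ A,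
        l = List.intercalate [Sum.inr ()] (List.ofFn fun i => (w i).map Sum.inl) } :
        Language (Δ ⊕ Unit)) ↔
    IsEDT0L ({ l : List (Δ ⊕ Fin n) | ∃ w ∈ A,
        l = (List.ofFn fun i => (w i).map Sum.inl ++ [Sum.inr i]).flatten } :
        Language (Δ ⊕ Fin n)) := by
  obtain ⟨k, rfl⟩ := Nat.exists_eq_succ_of_ne_zero hn.ne'
  constructor
  · intro hL
    let h : Δ ⊕ Unit → Fin (k + 1) := Sum.elim (fun _ => 0) (fun _ => 1)
    let out : Fin (k + 1) → Δ ⊕ Unit → List (Δ ⊕ Fin (k + 1)) :=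
      fun p => Sum.elim (fun d => [.inl d]) (fun _ => [.inr p])
    have key (w : Fin (k + 1) → List Δ) := transduce_single_hash h out id (fun _ => rfl)
      (fun _ _ => rfl) (fun _ _ => rfl) k w id (fun i => by simp [h])
    refine (congrArg IsEDT0L (Set.ext fun l => ?_)).mp (hL.transduce h out [.inr (Fin.last k)])
    constructor
    · rintro ⟨_, ⟨w, hw, rfl⟩, rfl⟩
      exact ⟨w, hw, key w⟩
    · rintro ⟨w, hw, rfl⟩
      exact ⟨_, ⟨w, hw, rfl⟩, (key w).symm⟩
  · intro hM
    let out : Unit → Δ ⊕ Fin (k + 1) → List (Δ ⊕ Unit) :=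
      fun _ => Sum.elim (fun d => [.inl d]) (fun i => if i = Fin.last k then [] else [.inr ()])
    have key (w : Fin (k + 1) → List Δ) := transduce_different_hashes (fun _ => ()) out
      (Fin.last k) (fun _ => rfl) (fun _ _ => rfl) (fun _ => by simp [out])
      (fun _ c hc => by simp [out, hc]) k w id (fun _ => Iff.rfl) 0
    refine (congrArg IsEDT0L (Set.ext fun l => ?_)).mp (hM.transduce (fun _ => ()) out [])
    constructor
    · rintro ⟨_, ⟨w, hw, rfl⟩, rfl⟩
      exact ⟨w, hw, by rw [List.append_nil]; exact key w⟩
    · rintro ⟨w, hw, rfl⟩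
      exact ⟨_, ⟨w, hw, rfl⟩, by rw [List.append_nil]; exact (key w).symm⟩

end Paper
end

section
/- Let L and M be EDT0L languages such that every word in L ∪ M contains precisely n occurrences of the letter #, where n ≥ 0. Then the language N = {u₀v₀ # u₁v₁ # ⋯ # uₙvₙ : u₀ # u₁ # ⋯ # uₙ ∈ L and v₀ # v₁ # ⋯ # vₙ ∈ M, where each uᵢ and each vᵢ contains no occurrence of #} is EDT0L. -/
namespace Paper

/-- The image of each letter under a word of letterwise substitutions followed by the final
substitution `ψ`. -/
def evalSub {C ι α : Type*} (tab : ι → C → List C) (ψ : C → List α) : List ι → C → List α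
  | [] => ψ
  | i :: is => fun c => (tab i c).flatMap (evalSub tab ψ is)

theorem flatMap_foldl_subApply {C ι α : Type*} (tab : ι → C → List C) (ψ : C → List α)
    (φs : List ι) (w : List C) :
    (φs.foldl (fun v i => subApply (tab i) v) w).flatMap ψ = w.flatMap (evalSub tab ψ φs) := by
  induction φs generalizing w with
  | nil => rfl
  | cons i is ih =>
    rw [List.foldl_cons, ih, subApply, ← List.flatMap_def, List.flatMap_assoc]
    rfl

/-- A predicate computed by a right-to-left scan with finitely many states is regular. -/
theorem isRegular_foldr {ι H : Type} [Finite H] (f : ι → H → H) (x : H) (A : Set H) :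
    Language.IsRegular ({w | w.foldr f x ∈ A} : Language ι) := by
  have := Fintype.ofFinite H
  refine Language.IsRegular.of_reverse ?_
  refine ⟨H, inferInstance, ⟨fun h i => f i h, x, A⟩, ?_⟩
  ext w
  change w.foldl (fun h i => f i h) x ∈ A ↔ w.reverse.foldr f x ∈ A
  rw [List.foldr_reverse]

theorem isRegular_comap_map {ι κ : Type} (f : κ → ι) {K : Language ι} (hK : K.IsRegular) :
    Language.IsRegular ({w | w.map f ∈ K} : Language κ) := by
  obtain ⟨σ, hσ, M, rfl⟩ := hK
  exact ⟨σ, hσ, M.comap f, DFA.accepts_comap M f⟩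

/-- The shuffle of two regular languages over disjoint alphabets is regular. -/
theorem isRegular_shuffle {ι κ : Type} {K : Language ι} {K' : Language κ}
    (hK : K.IsRegular) (hK' : K'.IsRegular) :
    Language.IsRegular ({w | w.filterMap Sum.getLeft? ∈ K ∧ w.filterMap Sum.getRight? ∈ K'} :
      Language (ι ⊕ κ)) := by
  obtain ⟨σ, hσ, M, rfl⟩ := hK
  obtain ⟨τ, hτ, M', rfl⟩ := hK'
  refine ⟨σ × τ, inferInstance,
    ⟨fun q i => i.elim (fun i => (M.step q.1 i, q.2)) (fun j => (q.1, M'.step q.2 j)),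
      (M.start, M'.start), {q | q.1 ∈ M.accept ∧ q.2 ∈ M'.accept}⟩, ?_⟩
  ext w
  simp only [DFA.mem_accepts, DFA.eval]
  change _ ↔ M.evalFrom M.start _ ∈ M.accept ∧ M'.evalFrom M'.start _ ∈ M'.accept
  generalize M.start = p, M'.start = q
  induction w generalizing p q with
  | nil => rfl
  | cons i w ih =>
    cases i with
    | inl i => exact ih (M.step p i) q
    | inr j => exact ih p (M'.step q j)

/-- A regular language followed by a fresh end marker is regular. -/
theorem isRegular_endMarker {ι : Type} {K : Language ι} (hK : K.IsRegular) :
    Language.IsRegular ({w | ∃ φs ∈ K, w = φs.map some ++ [none]} : Language (Option ι)) := by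
  classical
  obtain ⟨σ, hσ, M, rfl⟩ := hK
  let N : DFA (Option ι) (σ ⊕ Bool) :=
    ⟨fun q i => q.elim
        (fun q => i.elim (Sum.inr (decide (q ∈ M.accept))) fun i => Sum.inl (M.step q i))
        fun _ => Sum.inr false,
      Sum.inl M.start, {Sum.inr true}⟩
  have hdead : ∀ (w : List (Option ι)) (b : Bool),
      N.evalFrom (Sum.inr b) w ∈ N.accept ↔ b = true ∧ w = [] := by
    intro w
    induction w with
    | nil => intro b; simp [N]
    | cons i w ih =>
      intro b
      rw [DFA.evalFrom_cons]
      refine (ih false).trans ?_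
      simp
  refine ⟨_, inferInstance, N, ?_⟩
  ext w
  change N.evalFrom (Sum.inl M.start) w ∈ N.accept ↔
    ∃ φs, M.evalFrom M.start φs ∈ M.accept ∧ w = φs.map some ++ [none]
  generalize M.start = q
  induction w generalizing q with
  | nil => simp [N]
  | cons i w ih =>
    rw [DFA.evalFrom_cons]
    cases i with
    | none =>
      refine (hdead w _).trans ?_
      constructor
      · rintro ⟨h, rfl⟩
        exact ⟨[], by simpa using h, rfl⟩
      · rintro ⟨φs, h, e⟩
        cases φs with
        | nil => exact ⟨by simpa using h, by simpa using e⟩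
        | cons j φs => simp at e
    | some i =>
      refine (ih (M.step q i)).trans ?_
      constructor
      · rintro ⟨φs, h, rfl⟩
        exact ⟨i :: φs, h, rfl⟩
      · rintro ⟨φs, h, e⟩
        cases φs with
        | nil => simp at e
        | cons j φs =>
          simp only [List.map_cons, List.cons_append, List.cons.injEq, Option.some.injEq] at e
          obtain ⟨rfl, rfl⟩ := e
          exact ⟨φs, h, rfl⟩

/-- A system whose derivations end with an arbitrary final substitution into the terminal
alphabet, and whose start word may contain terminal letters, accepts an EDT0L language. -/
theorem isEDT0L_of_evalSub {α C ι : Type} [Finite α] [Finite C] [Finite ι]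
    (tab : ι → C → List C) (ψ : C → List α) (start : List (C ⊕ α)) {K : Language ι}
    (hK : K.IsRegular) :
    IsEDT0L ({w | ∃ φs ∈ K, w = start.flatMap (Sum.elim (evalSub tab ψ φs) fun a => [a])} :
      Language α) := by
  have := Fintype.ofFinite α
  have := Fintype.ofFinite C
  have := Fintype.ofFinite ι
  let tab' : Option ι → C ⊕ α → List (C ⊕ α) := fun i =>
    Sum.elim (fun c => i.elim ((ψ c).map Sum.inr) fun i => (tab i c).map Sum.inl)
      fun a => [Sum.inr a]
  have key : ∀ φs : List ι, evalSub tab' (fun x => [x]) (φs.map some ++ [none]) =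
      fun x => (Sum.elim (evalSub tab ψ φs) (fun a => [a]) x).map Sum.inr := by
    intro φs
    induction φs with
    | nil =>
      funext x
      cases x <;> simp [evalSub, tab']
    | cons i is ih =>
      funext x
      rw [List.map_cons, List.cons_append, evalSub, ih]
      cases x <;> simp [evalSub, tab', List.flatMap_map, List.map_flatMap]
  refine ⟨⟨C ⊕ α, inferInstance, Sum.getRight?, ?_, start, Option ι, inferInstance, tab', _,
    isRegular_endMarker hK⟩, ?_⟩
  · rintro (c | a) (c' | a') b <;> simp
    rintro rfl rfl
    rfl
  · ext w
    have step : ∀ φs : List ι,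
        (List.foldl (fun v i => subApply (tab' i) v) start (φs.map some ++ [none])).map
          Sum.getRight? =
        (start.flatMap (Sum.elim (evalSub tab ψ φs) fun a => [a])).map some := by
      intro φs
      have h := flatMap_foldl_subApply tab' (fun x => [x]) (φs.map some ++ [none]) start
      rw [List.flatMap_singleton', key] at h
      rw [h, ← List.map_flatMap, List.map_map]
      rfl
    constructor
    · rintro ⟨_, ⟨φs, hφ, rfl⟩, h⟩
      refine ⟨φs, hφ, ?_⟩
      exact (List.map_injective_iff.2 (Option.some_injective _) ((step φs).symm.trans h)).symm
    · rintro ⟨φs, hφ, rfl⟩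
      exact ⟨_, ⟨φs, hφ, rfl⟩, step φs⟩

/-- Every EDT0L language arises from a single start letter, with a final substitution into the
terminal alphabet in place of the intersection with the terminal words. -/
theorem IsEDT0L.exists_evalSub {α : Type} {L : Language α} (hL : IsEDT0L L) :
    ∃ (C ι : Type) (_ : Finite C) (_ : Finite ι) (tab : ι → C → List C) (ψ : C → List α)
      (c₀ : C) (K : Language ι), K.IsRegular ∧ L = {w | ∃ φs ∈ K, w = evalSub tab ψ φs c₀} := by
  obtain ⟨S, rfl⟩ := hL
  have := S.finC
  have := S.finι
  let ψ : S.C → List α := fun c => (S.term c).toList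
  let tab' : S.ι → Option S.C → List (Option S.C) := fun i c =>
    (c.elim (subApply (S.tab i) S.start) (S.tab i)).map some
  let ψ' : Option S.C → List α := fun c => c.elim (S.start.flatMap ψ) ψ
  let good : List S.ι → S.C → Prop :=
    List.foldr (fun i h c => ∀ d ∈ S.tab i c, h d) fun c => (S.term c).isSome
  have hgood : ∀ (φs : List S.ι) (w : List S.C),
      (∀ c ∈ w, good φs c) ↔ ∀ c ∈ S.apply φs w, (S.term c).isSome := by
    intro φs
    induction φs with
    | nil => intro w; rfl
    | cons i is ih =>
      intro w
      refine Iff.trans ?_ (ih (subApply (S.tab i) w))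
      simp only [subApply, ← List.flatMap_def, List.mem_flatMap]
      exact ⟨fun h c ⟨d, hd, hc⟩ => h d hd c hc, fun h d hd c hc => h c ⟨d, hd, hc⟩⟩
  have hsome : ∀ (φs : List S.ι) (c : S.C),
      evalSub tab' ψ' φs (some c) = evalSub S.tab ψ φs c := by
    intro φs
    induction φs with
    | nil => intro c; rfl
    | cons i is ih =>
      intro c
      simp only [evalSub, tab', Option.elim_some, List.flatMap_map, ih]
  have hnone : ∀ φs : List S.ι,
      evalSub tab' ψ' φs none = S.start.flatMap (evalSub S.tab ψ φs) := by
    intro φs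
    cases φs with
    | nil => rfl
    | cons i is =>
      rw [evalSub]
      simp only [tab', Option.elim_none, List.flatMap_map, hsome]
      rw [subApply, ← List.flatMap_def, List.flatMap_assoc]
      rfl
  have hterm : ∀ (v : List S.C) (w : List α), v.map S.term = w.map some ↔
      (∀ c ∈ v, (S.term c).isSome) ∧ w = v.flatMap ψ := by
    intro v
    induction v with
    | nil => intro w; simp
    | cons c v ih =>
      intro w
      rcases hc : S.term c with _ | a
      · cases w <;> simp [hc]
      · cases w with
        | nil => simp [hc, ψ]
        | cons b w =>
          simp only [List.map_cons, List.cons.injEq, ih, List.mem_cons, forall_eq_or_imp, hc,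
            List.flatMap_cons, ψ, Option.toList, List.singleton_append, Option.isSome_some,
            Option.some.injEq, true_and]
          tauto
  refine ⟨Option S.C, S.ι, inferInstance, inferInstance, tab', ψ', none,
    S.control ⊓ {φs | good φs ∈ {h | ∀ c ∈ S.start, h c}},
    S.control_reg.inf (isRegular_foldr _ _ _), ?_⟩
  ext w
  constructor
  · rintro ⟨φs, hφ, h⟩
    obtain ⟨h₁, h₂⟩ := (hterm _ _).1 h
    refine ⟨φs, ⟨hφ, (hgood _ _).2 h₁⟩, ?_⟩
    rw [h₂, hnone]
    exact flatMap_foldl_subApply _ _ _ _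
  · rintro ⟨φs, ⟨hφ, hg⟩, rfl⟩
    refine ⟨φs, hφ, (hterm _ _).2 ⟨(hgood _ _).1 hg, ?_⟩⟩
    rw [hnone]
    exact (flatMap_foldl_subApply _ _ _ _).symm

/-- The `k`-th factor (counting from zero) of a word cut at the occurrences of `hash`; it is
empty when there is no such factor. -/
def piece {α : Type*} [DecidableEq α] (hash : α) : List α → ℕ → List α
  | [], _ => []
  | a :: w, k =>
    if a = hash then (if k = 0 then [] else piece hash w (k - 1))
    else if k = 0 then a :: piece hash w 0 else piece hash w k

theorem piece_eq_getD_splitOn {α : Type*} [DecidableEq α] (hash : α) (w : List α) (k : ℕ) :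
    piece hash w k = (w.splitOn hash).getD k [] := by
  induction w generalizing k with
  | nil => cases k <;> simp [piece]
  | cons a w ih =>
    rw [List.splitOn_cons_eq_if_modifyHead, piece]
    by_cases h : a = hash
    · cases k <;> simp [h, ih]
    · have hne := List.splitOn_ne_nil hash w
      simp only [h, if_false, ih, beq_iff_eq]
      generalize w.splitOn hash = l at hne
      cases l with
      | nil => exact absurd rfl hne
      | cons x l => cases k <;> simp

theorem notMem_piece {α : Type*} [DecidableEq α] (hash : α) (w : List α) (k : ℕ) :
    hash ∉ piece hash w k := by
  induction w generalizing k with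
  | nil => simp [piece]
  | cons a w ih =>
    rw [piece]
    split_ifs with h h' h'
    · simp
    · exact ih _
    · simp [ih, Ne.symm h]
    · exact ih _

theorem length_splitOn {α : Type*} [DecidableEq α] (hash : α) (w : List α) :
    (w.splitOn hash).length = w.count hash + 1 := by
  induction w with
  | nil => simp
  | cons a w ih =>
    rw [List.splitOn_cons_eq_if_modifyHead]
    by_cases h : a = hash <;> simp [h, ih]

theorem intercalate_piece {α : Type*} [DecidableEq α] {hash : α} {w : List α} {n : ℕ}
    (hw : w.count hash = n) :
    List.intercalate [hash] (List.ofFn fun k : Fin (n + 1) => piece hash w k) = w := by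
  subst hw
  have h : (List.ofFn fun k : Fin (w.count hash + 1) => piece hash w k) = w.splitOn hash := by
    refine List.ext_getElem (by simp [length_splitOn]) fun k h₁ h₂ => ?_
    rw [List.getElem_ofFn, piece_eq_getD_splitOn, List.getD_eq_getElem _ _ h₂]
  rw [h, List.intercalate_splitOn]

theorem piece_intercalate {α : Type*} [DecidableEq α] {hash : α} {n : ℕ}
    (u : Fin (n + 1) → List α) (hu : ∀ i, hash ∉ u i) (k : Fin (n + 1)) :
    piece hash (List.intercalate [hash] (List.ofFn u)) k = u k := by
  rw [piece_eq_getD_splitOn, List.splitOn_intercalate]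
  · rw [List.getD_eq_getElem _ _ (by rw [List.length_ofFn]; exact k.2), List.getElem_ofFn]
  · intro l hl
    obtain ⟨i, rfl⟩ := (List.mem_ofFn' _ _).1 hl
    exact hu i
  · simp

theorem piece_append {α : Type*} [DecidableEq α] (hash : α) (v w : List α) (k : ℕ) :
    piece hash (v ++ w) k =
      piece hash v k ++ if v.count hash ≤ k then piece hash w (k - v.count hash) else [] := by
  induction v generalizing k with
  | nil => simp [piece]
  | cons a v ih =>
    rw [List.cons_append, piece, piece]
    by_cases h : a = hash
    · subst h
      cases k with
      | zero => simp
      | succ k => simp [ih]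
    · cases k with
      | zero => simp [h, ih]
      | succ k => simp [h, ih]

/-- The letters contributing to the `k`-th factor of the image of a word, a pair `(c, j)`
contributing the `j`-th factor of the image of `c`, when the image of `c` contains `h c` cuts. -/
def seg {C : Type*} {n : ℕ} (h : C → Fin (n + 2)) : List C → Fin (n + 1) → List (C × Fin (n + 1))
  | [], _ => []
  | c :: w, k => (c, k) :: if (h c : ℕ) ≤ k then
      seg h w ⟨k - h c, lt_of_le_of_lt (Nat.sub_le _ _) k.2⟩ else []

theorem piece_flatMap {α C : Type*} [DecidableEq α] {hash : α} {n : ℕ} (ρ : C → List α)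
    (h : C → Fin (n + 2)) (hh : ∀ c, (h c : ℕ) = min (n + 1) ((ρ c).count hash)) (w : List C)
    (k : Fin (n + 1)) :
    piece hash (w.flatMap ρ) k = (seg h w k).flatMap fun x => piece hash (ρ x.1) x.2 := by
  induction w generalizing k with
  | nil => simp [piece, seg]
  | cons c w ih =>
    have hk := k.2
    have hc := hh c
    rw [List.flatMap_cons, piece_append, seg, List.flatMap_cons]
    congr 1
    by_cases hle : (ρ c).count hash ≤ k
    · have e : (h c : ℕ) = (ρ c).count hash := by omega
      rw [if_pos hle, if_pos (e ▸ hle), ← ih]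
      simp only [e]
    · rw [if_neg hle, if_neg (by omega), List.flatMap_nil]

/-- The tuples of factors of the words of an EDT0L language with a fixed number of cuts are
generated in parallel from a tuple of start letters. -/
theorem IsEDT0L.exists_piece {α : Type} [DecidableEq α] {L : Language α} (hL : IsEDT0L L)
    (hash : α) (n : ℕ) :
    ∃ (D ι : Type) (_ : Finite D) (_ : Finite ι) (tab : ι → D → List D) (ψ : D → List α)
      (s : Fin (n + 1) → D) (K : Language ι), K.IsRegular ∧
      (fun w (k : Fin (n + 1)) => piece hash w k) '' L =
        (fun φs k => evalSub tab ψ φs (s k)) '' K := by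
  obtain ⟨C, ι, _, _, tab, ψ, c₀, K, hK, rfl⟩ := hL.exists_evalSub
  classical
  let H := C → Fin (n + 2)
  let cap : ℕ → Fin (n + 2) := fun m => ⟨min (n + 1) m, by omega⟩
  let cnt : List ι → H := fun φs c => cap ((evalSub tab ψ φs c).count hash)
  let next : ι → H → H := fun i h c => cap (((tab i c).map fun d => (h d : ℕ)).sum)
  have hcap : ∀ (ρ : C → List α) (w : List C), cap ((w.flatMap ρ).count hash) =
      cap ((w.map fun d => (cap ((ρ d).count hash) : ℕ)).sum) := by
    intro ρ w
    induction w with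
    | nil => rfl
    | cons c w ih =>
      simp only [cap, Fin.mk.injEq, List.flatMap_cons, List.count_append, List.map_cons,
        List.sum_cons] at ih ⊢
      omega
  have hcnt : ∀ i is, cnt (i :: is) = next i (cnt is) := fun i is => funext fun c => hcap _ _
  let scan : ι × H → Option H → Option H := fun x o =>
    o.bind fun h => if x.2 = h then some (next x.1 h) else none
  let tab' : ι × H → C × Fin (n + 1) → List (C × Fin (n + 1)) := fun x d =>
    seg x.2 (tab x.1 d.1) d.2
  let ψ' : C × Fin (n + 1) → List α := fun d => piece hash (ψ d.1) d.2
  have hscan : ∀ ws : List (ι × H), (ws.foldr scan (some (cnt []))).isSome →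
      ws.foldr scan (some (cnt [])) = some (cnt (ws.map Prod.fst)) ∧
      evalSub tab' ψ' ws =
        fun d => piece hash (evalSub tab ψ (ws.map Prod.fst) d.1) d.2 := by
    intro ws
    induction ws with
    | nil => intro _; exact ⟨rfl, rfl⟩
    | cons x ws ih =>
      intro hx
      rw [List.foldr_cons] at hx ⊢
      have hs : (ws.foldr scan (some (cnt []))).isSome := by
        by_contra hs
        rw [Option.not_isSome_iff_eq_none] at hs
        simp [hs, scan] at hx
      obtain ⟨h₁, h₂⟩ := ih hs
      rw [h₁] at hx ⊢
      have hx2 : x.2 = cnt (ws.map Prod.fst) := by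
        by_contra hne
        simp [scan, hne] at hx
      refine ⟨by simp [scan, hx2, hcnt], funext fun d => ?_⟩
      rw [evalSub, h₂, List.map_cons, evalSub]
      exact (piece_flatMap _ _ (fun c => by rw [hx2]) _ _).symm
  have hann : ∀ φs : List ι, ∃ ws : List (ι × H), ws.map Prod.fst = φs ∧
      (ws.foldr scan (some (cnt []))).isSome := by
    intro φs
    induction φs with
    | nil => exact ⟨[], rfl, rfl⟩
    | cons i is ih =>
      obtain ⟨ws, rfl, h⟩ := ih
      refine ⟨(i, cnt (ws.map Prod.fst)) :: ws, rfl, ?_⟩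
      rw [List.foldr_cons, (hscan ws h).1]
      simp [scan]
  refine ⟨C × Fin (n + 1), ι × H, inferInstance, inferInstance, tab', ψ', fun k => (c₀, k),
    {ws | ws.map Prod.fst ∈ K} ⊓ {ws | ws.foldr scan (some (cnt [])) ∈ {o | o.isSome}},
    (isRegular_comap_map _ hK).inf (isRegular_foldr _ _ _), ?_⟩
  ext t
  constructor
  · rintro ⟨_, ⟨φs, hφ, rfl⟩, rfl⟩
    obtain ⟨ws, rfl, h⟩ := hann φs
    exact ⟨ws, ⟨hφ, h⟩, by simp only [(hscan ws h).2]⟩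
  · rintro ⟨ws, ⟨hφ, h⟩, rfl⟩
    exact ⟨_, ⟨_, hφ, rfl⟩, by simp only [(hscan ws h).2]⟩

theorem flatMap_intercalate {α β : Type*} (g : α → List β) (s : List α) (ls : List (List α)) :
    (s.intercalate ls).flatMap g = (s.flatMap g).intercalate (ls.map (·.flatMap g)) := by
  induction ls with
  | nil => rfl
  | cons l ls ih =>
    cases ls with
    | nil => simp
    | cons l' ls =>
      simp only [List.map_cons, List.intercalate_cons_cons, List.flatMap_append] at ih ⊢
      rw [ih]

/-- The disjoint union of two systems derives each half of the alphabet independently. -/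
theorem evalSub_sum {α D D' ι ι' : Type*} (tab : ι → D → List D) (tab' : ι' → D' → List D')
    (ψ : D → List α) (ψ' : D' → List α) (ws : List (ι ⊕ ι')) :
    evalSub (Sum.elim
        (fun i => Sum.elim (fun d => (tab i d).map Sum.inl) fun d => [Sum.inr d])
        (fun i => Sum.elim (fun d => [Sum.inl d]) fun d => (tab' i d).map Sum.inr))
      (Sum.elim ψ ψ') ws =
    Sum.elim (evalSub tab ψ (ws.filterMap Sum.getLeft?))
      (evalSub tab' ψ' (ws.filterMap Sum.getRight?)) := by
  induction ws with
  | nil => rfl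
  | cons x ws ih =>
    funext d
    rw [evalSub, ih]
    rcases x with i | i <;> rcases d with d | d <;> simp [evalSub, List.flatMap_map, List.filterMap_cons]

theorem exists_shuffle {ι κ : Type*} (l : List ι) (r : List κ) :
    ∃ w : List (ι ⊕ κ), w.filterMap Sum.getLeft? = l ∧ w.filterMap Sum.getRight? = r :=
  ⟨l.map Sum.inl ++ r.map Sum.inr, by simp [List.filterMap_map, Function.comp_def],
    by simp [List.filterMap_map, Function.comp_def]⟩

/-- If `L` and `M` are EDT0L languages all of whose words contain exactly
`n` occurrences of `#`, then the parallel concatenation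
`{u₀v₀ # u₁v₁ # ⋯ # uₙvₙ : u₀#⋯#uₙ ∈ L, v₀#⋯#vₙ ∈ M}` (each `uᵢ`, `vᵢ` hash-free)
is EDT0L. -/
theorem edt0l_intermesh {α : Type} [Fintype α] [DecidableEq α]
    (hash : α) (n : ℕ) (L M : Language α) (hL : IsEDT0L L) (hM : IsEDT0L M)
    (hcount : ∀ u, u ∈ L ∨ u ∈ M → u.count hash = n) :
    IsEDT0L ({ w : List α | ∃ u v : Fin (n + 1) → List α,
        (∀ i, hash ∉ u i) ∧ (∀ i, hash ∉ v i) ∧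
        List.intercalate [hash] (List.ofFn u) ∈ L ∧
        List.intercalate [hash] (List.ofFn v) ∈ M ∧
        w = List.intercalate [hash] (List.ofFn fun i => u i ++ v i) } :
      Language α) := by
  obtain ⟨D, ι, _, _, tab, ψ, s, K, hK, h⟩ := hL.exists_piece hash n
  obtain ⟨D', ι', _, _, tab', ψ', s', K', hK', h'⟩ := hM.exists_piece hash n
  have key : ∀ {N : Language α}, (∀ u ∈ N, u.count hash = n) → ∀ u : Fin (n + 1) → List α,
      u ∈ (fun w (k : Fin (n + 1)) => piece hash w k) '' N ↔
        (∀ i, hash ∉ u i) ∧ List.intercalate [hash] (List.ofFn u) ∈ N := by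
    intro N hN u
    constructor
    · rintro ⟨w, hw, rfl⟩
      exact ⟨fun i => notMem_piece _ _ _, (intercalate_piece (hN w hw)).symm ▸ hw⟩
    · rintro ⟨hu, hw⟩
      exact ⟨_, hw, funext fun k => piece_intercalate u hu k⟩
  have keyL := key fun u hu => hcount u (Or.inl hu)
  have keyM := key fun u hu => hcount u (Or.inr hu)
  rw [h] at keyL
  rw [h'] at keyM
  have hout : ∀ ws : List (ι ⊕ ι'), (List.intercalate [Sum.inr hash]
      (List.ofFn fun k => [Sum.inl (Sum.inl (s k)), Sum.inl (Sum.inr (s' k))])).flatMap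
        (Sum.elim (Sum.elim (evalSub tab ψ (ws.filterMap Sum.getLeft?))
          (evalSub tab' ψ' (ws.filterMap Sum.getRight?))) fun a => [a]) =
      List.intercalate [hash] (List.ofFn fun k =>
        evalSub tab ψ (ws.filterMap Sum.getLeft?) (s k) ++
          evalSub tab' ψ' (ws.filterMap Sum.getRight?) (s' k)) := by
    intro ws
    rw [flatMap_intercalate, List.map_ofFn]
    simp [Function.comp_def]
  have hN := isEDT0L_of_evalSub
    (Sum.elim
      (fun i => Sum.elim (fun d => (tab i d).map Sum.inl) fun d => [Sum.inr d])
      (fun i => Sum.elim (fun d => [Sum.inl d]) fun d => (tab' i d).map Sum.inr))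
    (Sum.elim ψ ψ')
    (List.intercalate [Sum.inr hash]
      (List.ofFn fun k => [Sum.inl (Sum.inl (s k)), Sum.inl (Sum.inr (s' k))]))
    (isRegular_shuffle hK hK')
  refine (congrArg IsEDT0L (Set.ext fun w => ?_)).mpr hN
  constructor
  · rintro ⟨u, v, hu, hv, hul, hvm, rfl⟩
    obtain ⟨φs, hφ, rfl⟩ := (keyL u).2 ⟨hu, hul⟩
    obtain ⟨χs, hχ, rfl⟩ := (keyM v).2 ⟨hv, hvm⟩
    obtain ⟨ws, rfl, rfl⟩ := exists_shuffle φs χs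
    refine ⟨ws, ⟨hφ, hχ⟩, ?_⟩
    rw [evalSub_sum, hout]
  · rintro ⟨ws, ⟨hφ, hχ⟩, rfl⟩
    obtain ⟨hu, hul⟩ := (keyL _).1 ⟨_, hφ, rfl⟩
    obtain ⟨hv, hvm⟩ := (keyM _).1 ⟨_, hχ, rfl⟩
    refine ⟨_, _, hu, hv, hul, hvm, ?_⟩
    rw [evalSub_sum, hout]

end Paper
end

section
/- Let G be a finitely generated group with a finite index subgroup H, and let S ⊆ H. Then S is recognisable in G if and only if S is recognisable in H. Precisely: for any finite monoid generating set Σ_G of G with evaluation homomorphism π_G : Σ_G* → G and any finite monoid generating set Σ_H of H with evaluation homomorphism π_H : Σ_H* → H, the language π_G⁻¹(S) is regular if and only if the language π_H⁻¹(S) is regular. -/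
namespace Paper

section Recognisable

open scoped Pointwise

theorem surjective_prod_map_of_closure_range_eq_top {M ι : Type*} [Monoid M] (gen : ι → M)
    (h : Submonoid.closure (Set.range gen) = ⊤) :
    Function.Surjective fun w : List ι => (w.map gen).prod := by
  rw [← FreeMonoid.mrange_lift, MonoidHom.mrange_eq_top] at h
  intro g
  obtain ⟨w, rfl⟩ := h g
  exact ⟨w.toList, (FreeMonoid.lift_apply gen w).symm⟩

/-- The full preimage of `A` in the free monoid is regular iff the stabilizer of `A` under left
translation has finite index: the left quotients of the preimage are the preimages of the
translates of `A`. -/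
theorem isRegular_iff_finiteIndex_stabilizer {K ι : Type*} [Group K] (gen : ι → K)
    (h : Submonoid.closure (Set.range gen) = ⊤) {A : Set K} {L : Language ι}
    (hL : ∀ w, w ∈ L ↔ (w.map gen).prod ∈ A) :
    L.IsRegular ↔ (MulAction.stabilizer K A).FiniteIndex := by
  have hsurj := surjective_prod_map_of_closure_range_eq_top gen h
  set π : List ι → K := fun w => (w.map gen).prod
  let preim : Set K → Language ι := Set.preimage π
  have hinj : Function.Injective preim := Set.preimage_injective.mpr hsurj
  have hquot : L.leftQuotient = preim ∘ (fun g : K => g • A) ∘ (fun g : K => g⁻¹) ∘ π := by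
    funext x
    apply Set.ext
    intro y
    change x ++ y ∈ L ↔ π y ∈ (π x)⁻¹ • A
    rw [hL, Set.mem_inv_smul_set_iff, smul_eq_mul, List.map_append, List.prod_append]
  have hrange : Set.range L.leftQuotient = preim '' MulAction.orbit K A := by
    rw [hquot, Set.range_comp]
    exact congrArg _ ((inv_surjective.comp hsurj).range_comp _)
  rw [Language.isRegular_iff_finite_range_leftQuotient, hrange,
    Set.finite_image_iff hinj.injOn, ← Set.finite_coe_iff,
    (MulAction.orbitEquivQuotientStabilizer K A).finite_iff]
  exact Subgroup.finiteIndex_iff_finite_quotient.symm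

theorem stabilizer_preimage_coe {G : Type*} [Group G] (H : Subgroup G) {S : Set G}
    (hS : S ⊆ (H : Set G)) :
    MulAction.stabilizer H ((↑) ⁻¹' S : Set H) = (MulAction.stabilizer G S).subgroupOf H := by
  ext h
  rw [Subgroup.mem_subgroupOf, MulAction.mem_stabilizer_iff, MulAction.mem_stabilizer_iff,
    Set.ext_iff, Set.ext_iff]
  simp only [Set.mem_smul_set_iff_inv_smul_mem, Set.mem_preimage, smul_eq_mul,
    Subgroup.coe_mul, Subgroup.coe_inv]
  refine ⟨fun hh x => ?_, fun hh x => hh x⟩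
  by_cases hx : x ∈ H
  · exact hh ⟨x, hx⟩
  · refine iff_of_false (fun hmem => hx ?_) fun hmem => hx (hS hmem)
    exact (H.mul_mem_cancel_left (H.inv_mem h.2)).mp (hS hmem)

theorem finiteIndex_subgroupOf_iff {G : Type*} [Group G] (H K : Subgroup G) [H.FiniteIndex] :
    (K.subgroupOf H).FiniteIndex ↔ K.FiniteIndex := by
  refine ⟨fun h => ?_, fun _ => inferInstance⟩
  have hinf : (K ⊓ H).FiniteIndex := ⟨by
    rw [← Subgroup.relIndex_mul_index (inf_le_right : K ⊓ H ≤ H), Subgroup.inf_relIndex_right]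
    exact mul_ne_zero h.index_ne_zero Subgroup.FiniteIndex.index_ne_zero⟩
  exact Subgroup.finiteIndex_of_le (inf_le_left : K ⊓ H ≤ K)

end Recognisable

/-- Let `H` be a finite index subgroup of a finitely generated group `G`
and `S ⊆ H`. Then `S` is recognisable in `G` iff `S` is recognisable in `H`: for any
finite monoid generating sets of `G` and of `H`, the full preimage of `S` under the
corresponding evaluation map is regular for `G` iff it is regular for `H`. -/
theorem recognisable_finite_index {G : Type} [Group G] (H : Subgroup G) [H.FiniteIndex]
    (S : Set G) (hS : S ⊆ (H : Set G))
    {ιG ιH : Type} [Fintype ιG] [Fintype ιH]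
    (genG : ιG → G) (genH : ιH → H)
    (hgenG : Submonoid.closure (Set.range genG) = ⊤)
    (hgenH : Submonoid.closure (Set.range genH) = ⊤) :
    Language.IsRegular ({w : List ιG | (w.map genG).prod ∈ S} : Language ιG) ↔
    Language.IsRegular ({w : List ιH | ((w.map genH).prod : G) ∈ S} : Language ιH) := by
  refine (isRegular_iff_finiteIndex_stabilizer genG hgenG (A := S) fun _ => Iff.rfl).trans ?_
  rw [← finiteIndex_subgroupOf_iff H, ← stabilizer_preimage_coe H hS]
  exact (isRegular_iff_finiteIndex_stabilizer genH hgenH (A := (↑) ⁻¹' S) fun _ => Iff.rfl).symm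

end Paper
end

section
/- Let G be a group with finite generating set Σ, let H be a finite index subgroup of G, let T be a right transversal of H in G, let Z be the Schreier generating set for H, and let η be a normal form for (G, Σ). Let ζ be the Schreier normal form for (H, Z) with respect to η. If η is regular with respect to Σ, then ζ is regular with respect to Z (viewing Z as a finite alphabet of formal symbols indexed by pairs (t, x) ∈ T × Σ). -/
namespace Paper

/-- The Schreier rewriting of a word: given a transversal-representative function `rep`
and a word `a₁⋯aₘ` over `Σ ∪ Σ⁻¹`, starting at the transversal element `t`, produce the
word `(t₀a₁(t₀a₁)̄⁻¹)(t₁a₂(t₁a₂)̄⁻¹)⋯` over the Schreier generators `Z ∪ Z⁻¹`; a Schreier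
letter is a formal symbol indexed by a pair `(t, x) ∈ T × Σ` together with a sign
(a positive letter `((t,x),true)` stands for `tx(t̄x̄)⁻¹`, and `((t',x),false)` for its
inverse, which arises when the letter read is `x⁻¹`). -/
def schreierWord {G : Type} [Group G] {ι : Type} (rep : G → G) (gen : ι → G) :
    G → List (ι × Bool) → List ((G × ι) × Bool)
  | _, [] => []
  | t, (x, b) :: rest =>
    let a : G := if b then gen x else (gen x)⁻¹
    let t' := rep (t * a)
    (if b then ((t, x), true) else ((t', x), false)) :: schreierWord rep gen t' rest

/-- The value in `G` of a formal Schreier letter: `((t,x),true) ↦ tx(t̄x̄)⁻¹` and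
`((t,x),false)` is its inverse. -/
def schreierEval {G : Type} [Group G] {ι : Type} (rep : G → G) (gen : ι → G)
    (l : (G × ι) × Bool) : G :=
  if l.2 then l.1.1 * gen l.1.2 * (rep (l.1.1 * gen l.1.2))⁻¹
  else (l.1.1 * gen l.1.2 * (rep (l.1.1 * gen l.1.2))⁻¹)⁻¹

/-- The word length of an element of `H` with respect to the Schreier generating set
`Z = {tx(t̄x̄)⁻¹ : t ∈ T, x ∈ Σ}` (letters indexed by pairs `(t,x)` with `t` in the
transversal `T = range rep`). -/
noncomputable def schreierLength {G : Type} [Group G] {ι : Type} (rep : G → G)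
    (gen : ι → G) (h : G) : ℕ :=
  sInf {n | ∃ w : List ((G × ι) × Bool), (∀ l ∈ w, l.1.1 ∈ Set.range rep) ∧
    (w.map (schreierEval rep gen)).prod = h ∧ w.length = n}

/-- The value in `G` of a letter over `Σ ∪ Σ⁻¹`. -/
def letterVal {G : Type*} [Group G] {ι : Type*} (gen : ι → G) (l : ι × Bool) : G :=
  if l.2 then gen l.1 else (gen l.1)⁻¹

theorem evalWord_cons {G : Type*} [Group G] {ι : Type*} (gen : ι → G) (l : ι × Bool)
    (w : List (ι × Bool)) : evalWord gen (l :: w) = letterVal gen l * evalWord gen w := by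
  simp [evalWord, letterVal]

/-- The formal Schreier symbol output when the letter `l` is read at the coset
representative `t`. -/
def schreierLetter {G : Type*} [Group G] {ι : Type*} (rep : G → G) (gen : ι → G) (t : G)
    (l : ι × Bool) : (G × ι) × Bool :=
  ((if l.2 then t else rep (t * letterVal gen l), l.1), l.2)

theorem schreierWord_cons {G : Type} [Group G] {ι : Type} (rep : G → G) (gen : ι → G) (t : G)
    (l : ι × Bool) (w : List (ι × Bool)) :
    schreierWord rep gen t (l :: w) =
      schreierLetter rep gen t l :: schreierWord rep gen (rep (t * letterVal gen l)) w := by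
  obtain ⟨x, b⟩ := l
  cases b <;> simp [schreierWord, schreierLetter, letterVal]

/-- The image of a transversal-representative function of a finite index subgroup is finite. -/
theorem finite_range_rep {G : Type*} [Group G] (H : Subgroup G) [H.FiniteIndex] (rep : G → G)
    (hrep1 : ∀ g : G, g * (rep g)⁻¹ ∈ H)
    (hrep2 : ∀ g g' : G, g * g'⁻¹ ∈ H → rep g = rep g') : Finite (Set.range rep) := by
  refine Finite.of_injective (β := G ⧸ H) (fun t => ((t : G)⁻¹ : G)) ?_
  rintro ⟨_, g, rfl⟩ ⟨_, g', rfl⟩ h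
  rw [QuotientGroup.eq, inv_inv] at h
  have heq := hrep2 _ _ h
  rw [← hrep2 _ _ (hrep1 g), ← hrep2 _ _ (hrep1 g')] at heq
  exact Subtype.ext heq

open Classical in
/-- The automaton that undoes the Schreier rewriting: it tracks the state of `M` on the
original word together with the current coset representative, the state `none` being a sink
for words that are not Schreier rewritings. It accepts when `M` does and the current
representative lies in `H`. -/
noncomputable def schreierDFA {G : Type*} [Group G] {ι σ : Type*} (rep : G → G) (gen : ι → G)
    (H : Subgroup G) (M : DFA (ι × Bool) σ) :
    DFA ((G × ι) × Bool) (Option (σ × Set.range rep)) where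
  step s z := s.bind fun p =>
    if schreierLetter rep gen p.2 (z.1.2, z.2) = z then
      some (M.step p.1 (z.1.2, z.2), ⟨rep (p.2 * letterVal gen (z.1.2, z.2)), _, rfl⟩)
    else none
  start := some (M.start, ⟨rep 1, 1, rfl⟩)
  accept := {s | ∃ p, s = some p ∧ p.1 ∈ M.accept ∧ (p.2 : G) ∈ H}

theorem schreierDFA_evalFrom_none {G : Type*} [Group G] {ι σ : Type*} (rep : G → G)
    (gen : ι → G) (H : Subgroup G) (M : DFA (ι × Bool) σ) (v : List ((G × ι) × Bool)) :
    (schreierDFA rep gen H M).evalFrom none v = none := by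
  induction v with
  | nil => rfl
  | cons z v ih => exact ih

theorem rep_mul_mem_iff {G : Type*} [Group G] {H : Subgroup G} {rep : G → G}
    (hrep1 : ∀ g : G, g * (rep g)⁻¹ ∈ H) (g e : G) : rep g * e ∈ H ↔ g * e ∈ H := by
  rw [← H.mul_mem_cancel_left (hrep1 g)]
  group

theorem schreierDFA_evalFrom_mem_accept_iff {G : Type} [Group G] {ι : Type} {σ : Type*}
    (rep : G → G) (gen : ι → G) (H : Subgroup G) (hrep1 : ∀ g : G, g * (rep g)⁻¹ ∈ H)
    (M : DFA (ι × Bool) σ) (v : List ((G × ι) × Bool)) (q : σ) (t : Set.range rep) :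
    (schreierDFA rep gen H M).evalFrom (some (q, t)) v ∈ (schreierDFA rep gen H M).accept ↔
      ∃ w, schreierWord rep gen t w = v ∧ M.evalFrom q w ∈ M.accept ∧
        (t : G) * evalWord gen w ∈ H := by
  induction v generalizing q t with
  | nil =>
    constructor
    · rintro ⟨p, hp, hq, ht⟩
      obtain rfl := Option.some.inj hp
      exact ⟨[], rfl, hq, by simpa [evalWord] using ht⟩
    · rintro ⟨w, hw, hq, ht⟩
      cases w with
      | nil => exact ⟨(q, t), rfl, hq, by simpa [evalWord] using ht⟩
      | cons l w => simp [schreierWord_cons] at hw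
  | cons z v ih =>
    rw [DFA.evalFrom_cons]
    by_cases hz : schreierLetter rep gen t (z.1.2, z.2) = z
    · have hstep : (schreierDFA rep gen H M).step (some (q, t)) z =
          some (M.step q (z.1.2, z.2), ⟨rep (t * letterVal gen (z.1.2, z.2)), _, rfl⟩) := by
        simp [schreierDFA, hz]
      rw [hstep, ih]
      constructor
      · rintro ⟨w, hw, hq, ht⟩
        refine ⟨(z.1.2, z.2) :: w, by rw [schreierWord_cons, hz, hw], hq, ?_⟩
        rwa [rep_mul_mem_iff hrep1, mul_assoc, ← evalWord_cons] at ht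
      · rintro ⟨w, hw, hq, ht⟩
        cases w with
        | nil => simp [schreierWord] at hw
        | cons l w =>
          rw [schreierWord_cons] at hw
          obtain ⟨rfl, rfl⟩ := List.cons.inj hw
          refine ⟨w, rfl, hq, ?_⟩
          rw [rep_mul_mem_iff hrep1, mul_assoc]
          rwa [evalWord_cons] at ht
    · have hstep : (schreierDFA rep gen H M).step (some (q, t)) z = none := by
        simp [schreierDFA, hz]
      rw [hstep, schreierDFA_evalFrom_none]
      constructor
      · rintro ⟨p, hp, -⟩
        cases hp
      · rintro ⟨w, hw, -⟩
        cases w with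
        | nil => simp [schreierWord] at hw
        | cons l w =>
          rw [schreierWord_cons] at hw
          obtain ⟨rfl, -⟩ := List.cons.inj hw
          exact absurd rfl hz

/-- If `η` is a regular normal form for `(G, Σ)`, `H` is a finite index
subgroup with right transversal given by the representative function `rep`, then the
Schreier normal form `ζ(h) = schreierWord rep gen (rep 1) (η h)` for `(H, Z)` is regular
(over the alphabet of formal Schreier symbols indexed by `T × Σ`). -/
theorem schreier_normal_form_regular {G : Type} [Group G] {ι : Type} [Fintype ι]
    (gen : ι → G) (hgen : Subgroup.closure (Set.range gen) = ⊤)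
    (H : Subgroup G) [H.FiniteIndex] (rep : G → G)
    (hrep1 : ∀ g : G, g * (rep g)⁻¹ ∈ H)
    (hrep2 : ∀ g g' : G, g * g'⁻¹ ∈ H → rep g = rep g')
    (η : G → List (ι × Bool)) (hη : ∀ g, evalWord gen (η g) = g)
    (hreg : IsRegularNF η) :
    Language.IsRegular
      (Set.range (fun h : H => schreierWord rep gen (rep 1) (η (h : G))) :
        Language ((G × ι) × Bool)) := by
  obtain ⟨σ, _, M, hM⟩ := hreg
  have := finite_range_rep H rep hrep1 hrep2
  have := Fintype.ofFinite (Set.range rep)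
  refine ⟨_, inferInstance, schreierDFA rep gen H M, ?_⟩
  have hacc (w : List (ι × Bool)) : M.evalFrom M.start w ∈ M.accept ↔ w ∈ Set.range η :=
    Set.ext_iff.1 hM w
  ext v
  refine (schreierDFA_evalFrom_mem_accept_iff rep gen H hrep1 M v M.start _).trans ?_
  constructor
  · rintro ⟨w, hw, hq, ht⟩
    obtain ⟨g, rfl⟩ := (hacc w).1 hq
    rw [rep_mul_mem_iff hrep1, one_mul, hη] at ht
    exact ⟨⟨g, ht⟩, hw⟩
  · rintro ⟨h, hw⟩
    refine ⟨η h, hw, (hacc _).2 ⟨h, rfl⟩, ?_⟩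
    rw [rep_mul_mem_iff hrep1, one_mul, hη]
    exact h.2

end Paper
end

section
/- Let H be a finite index subgroup of a group G, let Σ_H be a finite generating set for H, let η_H be a normal form for (H, Σ_H), and let T be a right transversal of H in G. Take Σ = Σ_H ⊔ T as a generating set for G, and let η be the inherited normal form for (G, Σ) defined by η(g) = η_H(h_g) t_g, where g = h_g t_g is the unique factorisation with h_g ∈ H and t_g ∈ T. Then η_H is quasigeodesic (with respect to Σ_H) if and only if η is quasigeodesic (with respect to Σ). -/
namespace Paper

section Words

variable {G : Type*} [Group G] {ι : Type*}

theorem evalWord_append (gen : ι → G) (v w : List (ι × Bool)) :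
    evalWord gen (v ++ w) = evalWord gen v * evalWord gen w := by
  simp [evalWord]

theorem map_evalWord {K κ : Type*} [Group K] (f : G →* K) (gen : ι → G) (gen' : κ → K)
    (e : ι → κ) (he : ∀ i, gen' (e i) = f (gen i)) (w : List (ι × Bool)) :
    evalWord gen' (w.map fun l => (e l.1, l.2)) = f (evalWord gen w) := by
  simp only [evalWord, map_list_prod, List.map_map]
  congr 2
  funext ⟨i, b⟩
  cases b <;> simp [he]

theorem wordLength_evalWord_le (gen : ι → G) (w : List (ι × Bool)) :
    wordLength gen (evalWord gen w) ≤ w.length :=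
  Nat.sInf_le ⟨w, rfl, rfl⟩

theorem exists_length_eq_wordLength {gen : ι → G} (hgen : Function.Surjective (evalWord gen))
    (g : G) : ∃ w, evalWord gen w = g ∧ w.length = wordLength gen g :=
  Nat.sInf_mem (s := {n | ∃ w : List (ι × Bool), evalWord gen w = g ∧ w.length = n})
    ((hgen g).imp' List.length fun w hw => ⟨w, hw, rfl⟩)

theorem wordLength_mul_le {gen : ι → G} (hgen : Function.Surjective (evalWord gen))
    (g h : G) : wordLength gen (g * h) ≤ wordLength gen g + wordLength gen h := by
  obtain ⟨v, rfl, hv⟩ := exists_length_eq_wordLength hgen g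
  obtain ⟨w, rfl, hw⟩ := exists_length_eq_wordLength hgen h
  rw [← hv, ← hw, ← List.length_append, ← evalWord_append]
  exact wordLength_evalWord_le gen _

end Words

section Transversal

variable {G : Type*} [Group G] {H : Subgroup G} {rep : G → G}

theorem finite_range_of_transversal [H.FiniteIndex] (hrep1 : ∀ g : G, g * (rep g)⁻¹ ∈ H)
    (hrep2 : ∀ g g' : G, g * g'⁻¹ ∈ H → rep g = rep g') : Finite (Set.range rep) := by
  refine Finite.of_injective (fun t : Set.range rep => QuotientGroup.mk (s := H) (t : G)⁻¹) ?_
  rintro ⟨_, g, rfl⟩ ⟨_, g', rfl⟩ h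
  have h' : rep g * (rep g')⁻¹ ∈ H := by simpa using QuotientGroup.eq.mp h
  exact Subtype.ext <|
    (hrep2 _ _ (hrep1 g)).trans <| (hrep2 _ _ h').trans (hrep2 _ _ (hrep1 g')).symm

/-- The `H`-part of `g` has length at most linear in the length of a word representing `g`,
by the Schreier rewriting process. -/
theorem exists_wordLength_subgroup_part_le {ι κ : Type*} [Finite κ] [Finite (Set.range rep)]
    {genH : ι → H} (hgenH : Function.Surjective (evalWord genH)) (gen : κ → G)
    (hrep1 : ∀ g : G, g * (rep g)⁻¹ ∈ H)
    (hrep2 : ∀ g g' : G, g * g'⁻¹ ∈ H → rep g = rep g') :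
    ∃ C : ℕ, ∀ w : List (κ × Bool),
      wordLength genH ⟨evalWord gen w * (rep (evalWord gen w))⁻¹, hrep1 _⟩ ≤
        C * w.length + C := by
  set part : G → H := fun g => ⟨g * (rep g)⁻¹, hrep1 g⟩ with hpart
  have part_mul (g x : G) : part (g * x) = part g * part (rep g * x) := by
    have h : rep (g * x) = rep (rep g * x) := hrep2 _ _ (by simpa [mul_assoc] using hrep1 g)
    ext
    simp [hpart, h, mul_assoc]
  obtain ⟨C, hC⟩ := (Set.finite_range fun p : Set.range rep × (κ × Bool) =>
    wordLength genH (part (p.1 * evalWord gen [p.2]))).bddAbove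
  refine ⟨max C (wordLength genH (part 1)), fun w => ?_⟩
  induction w using List.reverseRecOn with
  | nil => simp [evalWord, hpart]
  | append_singleton w l ih =>
    have hl := hC ⟨(⟨_, Set.mem_range_self (evalWord gen w)⟩, l), rfl⟩
    have hm := wordLength_mul_le hgenH (part (evalWord gen w))
      (part (rep (evalWord gen w) * evalWord gen [l]))
    rw [← part_mul, ← evalWord_append] at hm
    rw [List.length_append, List.length_singleton, mul_add]
    have := le_max_left C (wordLength genH (part 1))
    simp only [hpart] at *
    lia

end Transversal

/-- Let `H` be a finite index subgroup of `G` with finite generating set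
`Σ_H` (indexed by `ιH`) and normal form `η_H`, and let `T = range rep` be a right
transversal. With `Σ = Σ_H ⊔ T` and the inherited normal form `η(g) = η_H(h_g)·t_g`
(where `g = h_g t_g`, `h_g ∈ H`, `t_g = rep g ∈ T`), `η_H` is quasigeodesic iff `η` is
quasigeodesic. -/
theorem inherited_normal_form_quasigeodesic_iff {G : Type} [Group G]
    (H : Subgroup G) [H.FiniteIndex]
    {ιH : Type} [Fintype ιH] (genH : ιH → H)
    (hgenH : Subgroup.closure (Set.range genH) = ⊤)
    (ηH : H → List (ιH × Bool)) (hηH : ∀ h : H, evalWord genH (ηH h) = h)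
    (rep : G → G)
    (hrep1 : ∀ g : G, g * (rep g)⁻¹ ∈ H)
    (hrep2 : ∀ g g' : G, g * g'⁻¹ ∈ H → rep g = rep g')
    (η : G → List ((ιH ⊕ ↥(Set.range rep)) × Bool))
    (hη : ∀ g : G, η g =
      ((ηH ⟨g * (rep g)⁻¹, hrep1 g⟩).map fun l => (Sum.inl l.1, l.2)) ++
        [(Sum.inr ⟨rep g, Set.mem_range_self g⟩, true)]) :
    IsQuasigeodesicNF genH ηH ↔
      IsQuasigeodesicNF
        (Sum.elim (fun i : ιH => ((genH i : H) : G)) (fun t : ↥(Set.range rep) => (t : G)))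
        η := by
  set gen : ιH ⊕ Set.range rep → G := Sum.elim (fun i => ((genH i : H) : G)) (fun t => (t : G))
    with hgen
  have surjH : Function.Surjective (evalWord genH) := fun h => ⟨_, hηH h⟩
  have eval_inl (w : List (ιH × Bool)) :
      evalWord gen (w.map fun l => (Sum.inl l.1, l.2)) = evalWord genH w :=
    map_evalWord H.subtype genH gen Sum.inl (fun _ => rfl) w
  have surj : Function.Surjective (evalWord gen) := fun g => ⟨η g, by
    rw [hη, evalWord_append, eval_inl, hηH]
    simp [evalWord, hgen]⟩
  have length_η (g : G) : (η g).length = (ηH ⟨g * (rep g)⁻¹, hrep1 g⟩).length + 1 := by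
    simp [hη]
  constructor
  · rintro ⟨lam, hlam, hle⟩
    have := finite_range_of_transversal hrep1 hrep2
    obtain ⟨C, hC⟩ := exists_wordLength_subgroup_part_le surjH gen hrep1 hrep2
    refine ⟨lam * C + lam + 1, by positivity, fun g => ?_⟩
    obtain ⟨w, rfl, hw⟩ := exists_length_eq_wordLength surj g
    have hC' := mul_le_mul_of_nonneg_left (Nat.cast_le (α := ℝ).mpr (hC w)) hlam.le
    have hη' := hle ⟨_, hrep1 (evalWord gen w)⟩
    rw [length_η, ← hw]
    push_cast at hC' ⊢
    have : 0 ≤ (lam + 1) * (w.length : ℝ) := by positivity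
    linarith
  · rintro ⟨lam, hlam, hle⟩
    refine ⟨2 * lam, by positivity, fun h => ?_⟩
    have rep_one : rep 1 ∈ H := by simpa using hrep1 1
    have rep_eq : rep (h * rep 1) = rep 1 :=
      hrep2 _ _ (by simpa using H.mul_mem h.2 rep_one)
    have part_eq : (⟨h * rep 1 * (rep (h * rep 1))⁻¹, hrep1 _⟩ : H) = h := by
      ext
      simp [rep_eq]
    have hbound : wordLength gen (h * rep 1) ≤ wordLength genH h + 1 := by
      obtain ⟨w, rfl, hw⟩ := exists_length_eq_wordLength surjH h
      have := wordLength_evalWord_le gen ((w.map fun l => (Sum.inl l.1, l.2)) ++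
        [(Sum.inr ⟨rep 1, Set.mem_range_self 1⟩, true)])
      rw [evalWord_append, eval_inl] at this
      simpa [evalWord, hgen, hw] using this
    have hη' := hle (h * rep 1)
    rw [length_η, part_eq] at hη'
    have hmul := mul_le_mul_of_nonneg_left (Nat.cast_le (α := ℝ).mpr hbound) hlam.le
    push_cast at hη' hmul
    have : 0 ≤ lam * (wordLength genH h : ℝ) := by positivity
    linarith

end Paper
end

section
/- Let G be a finitely generated group, let H be a finite index normal subgroup of G, let T be a (finite) right transversal of H in G, and let Ω ≤ Aut(H) be the group of automorphisms of H induced by conjugation of H by elements of G. Let S ⊆ Gⁿ be the solution set of a finite system of equations with rational constraints in n variables in G. Then there is a finite set B ⊆ Tⁿ and, for each t = (t₁, …, tₙ) ∈ B, a finite system of Ω-twisted equations with rational constraints in H with solution set A_t ⊆ Hⁿ, such that S = ⋃_{(t₁,…,tₙ) ∈ B} {(h₁t₁, …, hₙtₙ) : (h₁, …, hₙ) ∈ A_{(t₁,…,tₙ)}}. -/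
namespace Paper

section RationalSubset

variable {G ι : Type} [Group G] (H : Subgroup G) [H.Normal]

/-- The sequence of edges read off by a word in the Schreier graph of `H`, starting at `c`. -/
def schreierEdges (gen : ι → G) : G ⧸ H → List ι → List ((G ⧸ H) × ι)
  | _, [] => []
  | c, i :: w => (c, i) :: schreierEdges gen (c * (gen i : G)) w

/-- The product with a DFA of the Schreier graph of `H`, reading an initial marker followed by
edges of the Schreier graph, and accepting paths that end at the vertex `q`. The remaining letters,
those from `κ`, are never read. -/
def schreierNFA {σ κ : Type} (gen : ι → G) (M : DFA ι σ) (q : G ⧸ H) :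
    NFA (Option ((G ⧸ H) × ι) ⊕ κ) (Option (σ × (G ⧸ H))) where
  step
    | none, .inl none => {some (M.start, 1)}
    | some (s, c), .inl (some (c', i)) =>
      {y | c' = c ∧ y = some (M.step s i, c * (gen i : G))}
    | _, _ => ∅
  start := {none}
  accept := {y | ∃ s ∈ M.accept, y = some (s, q)}

lemma not_mem_acceptsFrom_empty {α σ : Type*} (N : NFA α σ) (v : List α) :
    v ∉ N.acceptsFrom ∅ := by
  induction v with
  | nil => simp
  | cons a v ih => simpa using ih

lemma mem_schreierNFA_acceptsFrom {σ κ : Type} (gen : ι → G) (M : DFA ι σ) (q : G ⧸ H)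
    (v : List (Option ((G ⧸ H) × ι) ⊕ κ)) (s : σ) (c : G ⧸ H) :
    v ∈ (schreierNFA H gen M q).acceptsFrom {some (s, c)} ↔
      ∃ w : List ι, v = (schreierEdges H gen c w).map (Sum.inl ∘ some) ∧
        M.evalFrom s w ∈ M.accept ∧ c * ((w.map gen).prod : G) = q := by
  induction v generalizing s c with
  | nil =>
    rw [NFA.nil_mem_acceptsFrom]
    constructor
    · rintro ⟨_, rfl, s', hs', h⟩
      obtain ⟨rfl, rfl⟩ : s = s' ∧ c = q := by simpa using h
      exact ⟨[], by simp [schreierEdges], by simpa using hs', by simp⟩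
    · rintro ⟨w, hw, hs, hc⟩
      cases w with
      | nil => exact ⟨_, rfl, s, by simpa using hs, by simpa using hc⟩
      | cons i w => simp [schreierEdges] at hw
  | cons a v ih =>
    rw [NFA.cons_mem_acceptsFrom, NFA.stepSet_singleton]
    rcases a with (_ | ⟨c', i⟩) | k
    · refine iff_of_false (not_mem_acceptsFrom_empty _ _) ?_
      rintro ⟨w, hw, -⟩
      cases w <;> simp [schreierEdges] at hw
    · by_cases hc : c' = c
      · subst hc
        have hstep : (schreierNFA (κ := κ) H gen M q).step (some (s, c')) (.inl (some (c', i))) =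
            {some (M.step s i, c' * (gen i : G))} := by
          ext y; simp [schreierNFA]
        rw [hstep, ih]
        constructor
        · rintro ⟨w, rfl, hs, hq⟩
          exact ⟨i :: w, by simp [schreierEdges], by simpa using hs, by simpa [mul_assoc] using hq⟩
        · rintro ⟨w, hw, hs, hq⟩
          cases w with
          | nil => simp [schreierEdges] at hw
          | cons j w =>
            simp only [schreierEdges, List.map_cons, List.cons.injEq, Function.comp_apply,
              Sum.inl.injEq, Option.some.injEq, Prod.mk.injEq, true_and] at hw
            obtain ⟨rfl, hw⟩ := hw
            exact ⟨w, hw, by simpa using hs, by simpa [mul_assoc] using hq⟩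
      · have hstep : (schreierNFA (κ := κ) H gen M q).step (some (s, c)) (.inl (some (c', i))) =
            ∅ := by
          ext y; simp [schreierNFA, hc]
        rw [hstep]
        refine iff_of_false (not_mem_acceptsFrom_empty _ _) ?_
        rintro ⟨w, hw, -⟩
        cases w with
        | nil => simp [schreierEdges] at hw
        | cons j w =>
          simp only [schreierEdges, List.map_cons, List.cons.injEq, Function.comp_apply,
            Sum.inl.injEq, Option.some.injEq, Prod.mk.injEq] at hw
          exact hc hw.1.1
    · refine iff_of_false (not_mem_acceptsFrom_empty _ _) ?_
      rintro ⟨w, hw, -⟩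
      cases w <;> simp [schreierEdges] at hw

lemma mem_schreierNFA_accepts {σ κ : Type} (gen : ι → G) (M : DFA ι σ) (q : G ⧸ H)
    (v : List (Option ((G ⧸ H) × ι) ⊕ κ)) :
    v ∈ (schreierNFA H gen M q).accepts ↔
      ∃ w ∈ M.accepts, v = .inl none :: (schreierEdges H gen 1 w).map (Sum.inl ∘ some) ∧
        ((w.map gen).prod : G ⧸ H) = q := by
  have hstart : (schreierNFA (κ := κ) H gen M q).start = {none} := rfl
  rw [NFA.accepts_eq_acceptsFrom_start, hstart]
  rcases v with _ | ⟨(_ | e) | k, v⟩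
  · rw [NFA.nil_mem_acceptsFrom]
    simp [schreierNFA]
  · rw [NFA.cons_mem_acceptsFrom, NFA.stepSet_singleton]
    have hstep : (schreierNFA (κ := κ) H gen M q).step none (.inl none) =
        {some (M.start, 1)} := rfl
    rw [hstep, mem_schreierNFA_acceptsFrom]
    constructor
    · rintro ⟨w, rfl, hs, hq⟩
      exact ⟨w, hs, rfl, by simpa using hq⟩
    · rintro ⟨w, hs, hv, hq⟩
      exact ⟨w, by simpa using hv, hs, by simpa using hq⟩
  · rw [NFA.cons_mem_acceptsFrom, NFA.stepSet_singleton]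
    exact iff_of_false (not_mem_acceptsFrom_empty _ _) (by simp)
  · rw [NFA.cons_mem_acceptsFrom, NFA.stepSet_singleton]
    exact iff_of_false (not_mem_acceptsFrom_empty _ _) (by simp)

/-- The Schreier generators of `H` determined by a section `τ` of the quotient map. -/
def schreierGen (gen : ι → G) {τ : G ⧸ H → G} (hτ : ∀ c, (τ c : G ⧸ H) = c)
    (e : (G ⧸ H) × ι) : H :=
  ⟨τ e.1 * gen e.2 * (τ (e.1 * (gen e.2 : G)))⁻¹, by
    rw [← QuotientGroup.eq_one_iff]; simp [hτ]⟩

lemma coe_prod_schreierGen (gen : ι → G) {τ : G ⧸ H → G} (hτ : ∀ c, (τ c : G ⧸ H) = c)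
    (c : G ⧸ H) (w : List ι) :
    ((((schreierEdges H gen c w).map (schreierGen H gen hτ)).prod : H) : G) =
      τ c * (w.map gen).prod * (τ (c * ((w.map gen).prod : G)))⁻¹ := by
  induction w generalizing c with
  | nil => simp [schreierEdges]
  | cons i w ih =>
    simp only [schreierEdges, List.map_cons, List.prod_cons, Subgroup.coe_mul, ih]
    simp [schreierGen, mul_assoc]

lemma IsRationalSubset.group_fg {A : Set G} (hA : IsRationalSubset A) : Group.FG G := by
  obtain ⟨ι, _, gen, L, hgen, -, -⟩ := hA
  rw [Group.fg_iff_monoid_fg, Monoid.fg_iff]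
  exact ⟨_, hgen, Set.finite_range gen⟩

/-- The part of a rational subset lying in a coset of a normal subgroup of finite index, translated
into the subgroup, is rational. -/
lemma IsRationalSubset.preimage_mul_right [H.FiniteIndex] {A : Set G} (hA : IsRationalSubset A)
    (t : G) : IsRationalSubset {h : H | (h : G) * t ∈ A} := by
  classical
  have := hA.group_fg
  obtain ⟨S, hS, hSfin⟩ := Monoid.fg_iff.1 (Group.fg_iff_monoid_fg.1 (inferInstance : Group.FG H))
  have := hSfin.fintype
  obtain ⟨ι, _, gen, L, -, ⟨σ, _, M, rfl⟩, rfl⟩ := hA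
  obtain ⟨τ, hτ, hτt⟩ : ∃ τ : G ⧸ H → G, (∀ c, (τ c : G ⧸ H) = c) ∧ τ t = t := by
    refine ⟨Function.update Quotient.out (t : G ⧸ H) t, fun c => ?_, by simp⟩
    by_cases hc : c = t
    · simp [hc]
    · simp [hc]
  have : Fintype (G ⧸ H) := Fintype.ofFinite _
  let b : Option ((G ⧸ H) × ι) ⊕ S → H :=
    Sum.elim (fun o => o.elim ⟨(τ 1)⁻¹, by rw [← QuotientGroup.eq_one_iff]; simp [hτ]⟩
      (schreierGen H gen hτ)) Subtype.val
  have hb (w : List ι) :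
      ((((.inl none :: (schreierEdges H gen 1 w).map (Sum.inl ∘ some)).map b).prod : H) : G) =
        (w.map gen).prod * (τ ((w.map gen).prod : G))⁻¹ := by
    have hcomp : b ∘ Sum.inl ∘ some = schreierGen H gen hτ := rfl
    rw [List.map_cons, List.map_map, hcomp, List.prod_cons, Subgroup.coe_mul,
      coe_prod_schreierGen, one_mul]
    simp [b, mul_assoc]
  refine ⟨_, inferInstance, b, (schreierNFA H gen M (t : G ⧸ H)).accepts, ?_, ?_, ?_⟩
  · rw [eq_top_iff, ← hS]
    exact Submonoid.closure_mono fun s hs => ⟨.inr ⟨s, hs⟩, rfl⟩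
  · exact ⟨_, inferInstance, _, NFA.toDFA_correct⟩
  · ext h
    constructor
    · rintro ⟨w, hw, hwt⟩
      have hq : ((w.map gen).prod : G ⧸ H) = t := by
        have hwt' : (w.map gen).prod = h * t := hwt
        rw [hwt', QuotientGroup.mk_mul, (QuotientGroup.eq_one_iff _).2 h.2, one_mul]
      refine ⟨_, (mem_schreierNFA_accepts H gen M _ _).2 ⟨w, hw, rfl, hq⟩, ?_⟩
      apply Subtype.ext
      refine (hb w).trans ?_
      rw [hq, hτt]
      exact mul_inv_eq_of_eq_mul hwt
    · rintro ⟨v, hv, rfl⟩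
      obtain ⟨w, hw, rfl, hq⟩ := (mem_schreierNFA_accepts H gen M _ _).1 hv
      refine ⟨w, hw, ?_⟩
      refine Eq.trans ?_ (congrArg (· * t) (hb w)).symm
      simp [hq, hτt]

end RationalSubset

section TwistedEquations

variable {G : Type*} [Group G] {n : ℕ}

/-- Evaluate an element of `G ∗ F_X` at an assignment of the variables. -/
def evalEquation (g : Fin n → G) : Monoid.Coprod G (FreeGroup (Fin n)) →* G :=
  Monoid.Coprod.lift (MonoidHom.id G) (FreeGroup.lift g)

lemma twistedEval_append {H : Type*} [Group H] (Ω : Subgroup (MulAut H)) (h : Fin n → H)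
    (v w : List (H ⊕ (FreeGroup (Fin n) × Ω))) :
    twistedEval Ω h (v ++ w) = twistedEval Ω h v * twistedEval Ω h w := by
  simp [twistedEval]

lemma exists_twistedEval_eq_apply {H : Type*} [Group H] (Ω : Subgroup (MulAut H)) (α : Ω)
    (w : List (H ⊕ (FreeGroup (Fin n) × Ω))) :
    ∃ w' : List (H ⊕ (FreeGroup (Fin n) × Ω)), ∀ h : Fin n → H,
      twistedEval Ω h w' = (α : MulAut H) (twistedEval Ω h w) := by
  refine ⟨w.map (Sum.map (α : MulAut H) fun p => (p.1, α * p.2)), fun h => ?_⟩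
  unfold twistedEval
  rw [map_list_prod, List.map_map, List.map_map]
  congr 2
  funext x
  rcases x with x | ⟨u, ψ⟩ <;> simp

variable (H : Subgroup G) [H.Normal]

/-- Replacing each variable `Xᵢ` by `Xᵢtᵢ`, the constants `tᵢ` can be pushed to the right of an
equation at the cost of twisting the variables. -/
lemma exists_twistedEval_mul_eq (t : Fin n → G) (e : Monoid.Coprod G (FreeGroup (Fin n))) :
    ∃ w : List (H ⊕ (FreeGroup (Fin n) × (MulAut.conjNormal (H := H)).range)), ∀ h : Fin n → H,
      evalEquation (fun i => (h i : G) * t i) e =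
        ((twistedEval (MulAut.conjNormal (H := H)).range h w : H) : G) * evalEquation t e := by
  have hmul (x y : Monoid.Coprod G (FreeGroup (Fin n)))
      (hx : ∃ w : List (H ⊕ (FreeGroup (Fin n) × (MulAut.conjNormal (H := H)).range)),
        ∀ h : Fin n → H, evalEquation (fun i => (h i : G) * t i) x =
          ((twistedEval (MulAut.conjNormal (H := H)).range h w : H) : G) * evalEquation t x)
      (hy : ∃ w : List (H ⊕ (FreeGroup (Fin n) × (MulAut.conjNormal (H := H)).range)),
        ∀ h : Fin n → H, evalEquation (fun i => (h i : G) * t i) y =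
          ((twistedEval (MulAut.conjNormal (H := H)).range h w : H) : G) * evalEquation t y) :
      ∃ w : List (H ⊕ (FreeGroup (Fin n) × (MulAut.conjNormal (H := H)).range)),
        ∀ h : Fin n → H, evalEquation (fun i => (h i : G) * t i) (x * y) =
          ((twistedEval (MulAut.conjNormal (H := H)).range h w : H) : G) * evalEquation t (x * y) := by
    obtain ⟨v, hv⟩ := hx
    obtain ⟨w, hw⟩ := hy
    obtain ⟨w', hw'⟩ := exists_twistedEval_eq_apply (MulAut.conjNormal (H := H)).range
      ⟨MulAut.conjNormal (evalEquation t x), _, rfl⟩ w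
    refine ⟨v ++ w', fun h => ?_⟩
    rw [twistedEval_append, hw', map_mul, map_mul, hv, hw, Subgroup.coe_mul,
      MulAut.conjNormal_apply]
    group
  induction e using Monoid.Coprod.induction_on with
  | inl g => exact ⟨[], fun h => by simp [evalEquation, twistedEval]⟩
  | inr u =>
    induction u using FreeGroup.induction_on with
    | C1 => exact ⟨[], fun h => by simp [twistedEval]⟩
    | of i => exact ⟨[.inr (FreeGroup.of i, 1)], fun h => by simp [evalEquation, twistedEval]⟩
    | inv_of i _ =>
      exact ⟨[.inr ((FreeGroup.of i)⁻¹, ⟨MulAut.conjNormal (t i)⁻¹, _, rfl⟩)],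
        fun h => by simp [evalEquation, twistedEval, mul_assoc]⟩
    | mul u v hu hv => simpa only [map_mul] using hmul _ _ hu hv
  | mul x y hx hy => exact hmul x y hx hy

/-- If the constant part of an equation lies in `H`, the substitution `Xᵢ ↦ Xᵢtᵢ` turns the equation
into a twisted equation in `H`. -/
lemma exists_twistedEval_eq_one_iff (t : Fin n → G) (e : Monoid.Coprod G (FreeGroup (Fin n)))
    (he : evalEquation t e ∈ H) :
    ∃ w : List (H ⊕ (FreeGroup (Fin n) × (MulAut.conjNormal (H := H)).range)), ∀ h : Fin n → H,
      twistedEval (MulAut.conjNormal (H := H)).range h w = 1 ↔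
        evalEquation (fun i => (h i : G) * t i) e = 1 := by
  obtain ⟨w, hw⟩ := exists_twistedEval_mul_eq H t e
  refine ⟨w ++ [.inl ⟨_, he⟩], fun h => ?_⟩
  rw [hw, twistedEval_append, ← OneMemClass.coe_eq_one]
  simp [twistedEval]

lemma evalEquation_mem_of_eq_one (t : Fin n → G) (h : Fin n → H)
    (e : Monoid.Coprod G (FreeGroup (Fin n)))
    (he : evalEquation (fun i => (h i : G) * t i) e = 1) : evalEquation t e ∈ H := by
  obtain ⟨w, hw⟩ := exists_twistedEval_mul_eq H t e
  rw [← H.mul_mem_cancel_left (twistedEval _ h w).2, ← hw, he]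
  exact H.one_mem

end TwistedEquations

/-- Let `H` be a finite index normal subgroup of `G` with right
transversal `T = range rep`, and let `Ω ≤ Aut(H)` be the automorphisms induced by
conjugation by elements of `G`. For any finite system of equations with rational
constraints in `G` in `n` variables, with solution set `S`, there are a finite set
`B ⊆ Tⁿ` and, for each `t ∈ B`, a finite system of `Ω`-twisted equations with rational
constraints in `H` with solution set `A_t`, such that
`S = ⋃_{t ∈ B} {(h₁t₁,…,hₙtₙ) : (h₁,…,hₙ) ∈ A_t}`. -/
theorem equations_in_finite_extension {G : Type} [Group G]
    (H : Subgroup G) [H.Normal] [H.FiniteIndex]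
    (rep : G → G)
    (hrep1 : ∀ g : G, g * (rep g)⁻¹ ∈ H)
    (hrep2 : ∀ g g' : G, g * g'⁻¹ ∈ H → rep g = rep g')
    (n : ℕ) (E : Set (Monoid.Coprod G (FreeGroup (Fin n)))) (hE : E.Finite)
    (Rc : Fin n → Set G) (hRc : ∀ i, IsRationalSubset (Rc i)) :
    ∃ (B : Set (Fin n → G))
      (TE : (Fin n → G) →
        Set (List ((↥H) ⊕ (FreeGroup (Fin n) × ↥(MulAut.conjNormal (H := H)).range))))
      (TC : (Fin n → G) → Fin n → Set ↥H),
      B.Finite ∧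
      (∀ t ∈ B, ∀ i, t i ∈ Set.range rep) ∧
      (∀ t ∈ B, (TE t).Finite) ∧
      (∀ t ∈ B, ∀ i, IsRationalSubset (TC t i)) ∧
      {g : Fin n → G | SolvesSystem E g ∧ ∀ i, g i ∈ Rc i} =
        ⋃ t ∈ B, {g : Fin n → G | ∃ h : Fin n → ↥H,
          (∀ w ∈ TE t, twistedEval (MulAut.conjNormal (H := H)).range h w = 1) ∧
          (∀ i, h i ∈ TC t i) ∧
          (∀ i, g i = (h i : G) * t i)} := by
  classical
  have hrange : (Set.range rep).Finite := by
    refine (Set.finite_range fun c : G ⧸ H => rep c.out).subset ?_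
    rintro _ ⟨g, rfl⟩
    refine ⟨(g : G ⧸ H), hrep2 _ _ ?_⟩
    rw [← QuotientGroup.eq_one_iff]
    simp
  choose! W hW using exists_twistedEval_eq_one_iff H (n := n)
  refine ⟨{t | (∀ i, t i ∈ Set.range rep) ∧ ∀ e ∈ E, evalEquation t e ∈ H},
    fun t => W t '' E, fun t i => {h | (h : G) * t i ∈ Rc i}, ?_, fun t ht => ht.1,
    fun t _ => hE.image _, fun t _ i => (hRc i).preimage_mul_right H (t i), ?_⟩
  · exact (Set.Finite.pi' fun _ => hrange).subset fun t ht => ht.1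
  · ext g
    simp only [Set.mem_ofPred_eq, Set.mem_iUnion, exists_prop, Set.forall_mem_image]
    constructor
    · rintro ⟨hg, hgR⟩
      let h : Fin n → H := fun i => ⟨g i * (rep (g i))⁻¹, hrep1 _⟩
      have hgh : (fun i => (h i : G) * rep (g i)) = g := by funext i; simp [h]
      have hgE : ∀ e ∈ E, evalEquation (fun i => (h i : G) * rep (g i)) e = 1 := by
        rw [hgh]; exact hg
      have hB : ∀ e ∈ E, evalEquation (fun i => rep (g i)) e ∈ H := fun e he =>
        evalEquation_mem_of_eq_one H _ h e (hgE e he)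
      refine ⟨fun i => rep (g i), ⟨fun i => ⟨_, rfl⟩, hB⟩, h,
        fun e he => (hW _ e (hB e he) h).2 (hgE e he), fun i => ?_, fun i => by simp [h]⟩
      simpa [h] using hgR i
    · rintro ⟨t, ⟨-, ht⟩, h, hE', hR, hg⟩
      obtain rfl : g = fun i => (h i : G) * t i := funext hg
      exact ⟨fun e he => (hW t e (ht e he) h).1 (hE' he), hR⟩

end Paper
end
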